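/- (Main theorem, first component) There exists an open connected set A₁ ⊆ ℝ² containing the segment I₁ = [5.3125, 5.46875] × {1} such that for every (a,b) ∈ A₁, the Hénon map H_{a,b} restricted to K^ℝ_{a,b} is topologically conjugate to the shift σ restricted to Fix(ρ_{2,2}): there exists a homeomorphism h from K^ℝ_{a,b} (with the subspace topology of ℝ²) onto Fix(ρ_{2,2}) (with the subspace topology of Σ₂) such that h(H_{a,b}(p)) = σ(h(p)) for all p ∈ K^ℝ_{a,b}. -/

import Mathlib

/-- The Hénon map `H_{a,b}(x,y) = (a - x² - b·y, x)` on `ℝ²`. -/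
def henon (a b : ℝ) (p : ℝ × ℝ) : ℝ × ℝ := (a - p.1 ^ 2 - b * p.2, p.1)

/-- `K^ℝ_{a,b}`: the set of points whose full orbit `{H^n(p) : n ∈ ℤ}` is bounded.
A full orbit through `p` is a sequence `o : ℤ → ℝ²` with `o 0 = p` and
`o (n+1) = H (o n)` for all `n ∈ ℤ`. -/
def henonK (a b : ℝ) : Set (ℝ × ℝ) :=
  {p | ∃ o : ℤ → ℝ × ℝ, o 0 = p ∧ (∀ n : ℤ, o (n + 1) = henon a b (o n)) ∧
    Bornology.IsBounded (Set.range o)}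

/-- The full 2-shift `Σ₂ = {0,1}^ℤ` (product topology, `{0,1}` discrete). -/
abbrev Sigma2 := ℤ → Fin 2

/-- The shift map `(σ s)_i = s_{i+1}`. -/
def shift (s : Sigma2) : Sigma2 := fun i => s (i + 1)

/-- The pruning pattern occurs in `s` at position `i` if `s_{i-1} = 1`, `s_{i+1} = 1`,
`s_{i-1-k} = 0` for `1 ≤ k ≤ N` and `s_{i+1+k} = 0` for `1 ≤ k ≤ M`. -/
def pattern (N M : ℕ) (s : Sigma2) (i : ℤ) : Prop :=
  s (i - 1) = 1 ∧ s (i + 1) = 1 ∧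
    (∀ k : ℕ, 1 ≤ k → k ≤ N → s (i - 1 - (k : ℤ)) = 0) ∧
    (∀ k : ℕ, 1 ≤ k → k ≤ M → s (i + 1 + (k : ℤ)) = 0)

open Classical in
/-- The pruning automorphism `ρ_{N,M}`: it flips coordinate `i` exactly when the
pruning pattern occurs in `s` at position `i`. -/
noncomputable def rho (N M : ℕ) (s : Sigma2) : Sigma2 :=
  fun i => if pattern N M s i then 1 - s i else s i

/-- The fixed-point set of `ρ_{N,M}`. -/
def fixSet (N M : ℕ) : Set Sigma2 := {s | rho N M s = s}

namespace HP

/-- values are scaled by `10000` and shifted by `40000`; clamp data `M` means `X^2 < M` possible -/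
structure Cell where
  lo : Nat
  hi : Nat
  M : Nat

def mx (a b : Nat) : Nat := cond (Nat.ble a b) b a
def mn (a b : Nat) : Nat := cond (Nat.ble a b) a b
def sq (a : Nat) : Nat := Nat.mul a a

/-- a Newton step for the square root -/
def nst (t v : Nat) : Nat := Nat.add (Nat.div (Nat.add v (Nat.div t v)) 2) 1
def nst3 (t v : Nat) : Nat := nst t (nst t (nst t (Nat.add v 1)))

/-- upper bound for the root of `t`, if at most `v` -/
def rup1 (t v u : Nat) : Nat := cond (Nat.ble t (sq u)) (mn u v) v
def rup (t v : Nat) : Nat := cond (Nat.ble (sq v) t) v (rup1 t v (nst3 t v))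

/-- lower bound for the root of `t`, if at least `p` -/
def rdn1 (t p u : Nat) : Nat := cond (Nat.ble (sq u) t) (mx u p) p
def rdn (t p v : Nat) : Nat := cond (Nat.ble t (sq p)) p (rdn1 t p (Nat.div t (nst3 t v)))

def fin (A1 : Nat) (l r : Cell) (c : Cell) (nl ls : Nat) : Option (Cell × Cell × Cell) :=
  let rl := mx r.lo (Nat.sub ls l.hi)
  let ll := mx l.lo (Nat.sub ls r.hi)
  let hs := Nat.sub A1 (Nat.div (sq nl) 10000)
  let w := Nat.blt (sq nl) c.M
  let rh := cond w r.hi (mn r.hi (Nat.sub hs ll))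
  let lh := cond w l.hi (mn l.hi (Nat.sub hs rl))
  cond (Nat.ble rl rh && Nat.ble ll lh) (some (⟨ll, lh, l.M⟩, c, ⟨rl, rh, r.M⟩)) none

/-- here `A0`, `A1` are shifted by `80000` -/
def tri (A0 A1 : Nat) (l c r : Cell) : Option (Cell × Cell × Cell) :=
  let hb := mx (Nat.mul 10000 (Nat.sub A1 (Nat.add l.lo r.lo))) c.M
  let lb := Nat.mul 10000 (Nat.sub A0 (Nat.add l.hi r.hi))
  cond (Nat.ble 40000 c.lo)
    (let mh := Nat.sub c.hi 40000
     let nh := rup hb mh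
     let nl := rdn lb (Nat.sub c.lo 40000) mh
     cond (Nat.ble nl nh)
      (fin A1 l r ⟨Nat.add 40000 nl, Nat.add 40000 nh, c.M⟩ nl
        (Nat.sub A0 (Nat.add (Nat.div (sq nh) 10000) 1))) none)
    (cond (Nat.ble c.hi 40000)
    (let mh := Nat.sub 40000 c.lo
     let nh := rup hb mh
     let nl := rdn lb (Nat.sub 40000 c.hi) mh
     cond (Nat.ble nl nh)
      (fin A1 l r ⟨Nat.sub 40000 nh, Nat.sub 40000 nl, c.M⟩ nl
        (Nat.sub A0 (Nat.add (Nat.div (sq nh) 10000) 1))) none)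
    (some (l, c, r)))

def sweep (A0 A1 : Nat) (acc : List Cell) (l c : Cell) : List Cell → Option (List Cell)
  | [] => some (c :: l :: acc)
  | r :: t => match tri A0 A1 l c r with
    | none => none
    | some (l', c', r') => sweep A0 A1 (l' :: acc) c' r' t

/-- `true` means infeasible -/
def contr (A0 A1 : Nat) : Nat → List Cell → Bool
  | 0, _ => false
  | n + 1, l :: c :: t => match sweep A0 A1 [] l c t with
    | none => true
    | some b => contr A0 A1 n b
  | _ + 1, _ => false

def tab (l2 l1 c r1 r2 : Bool) : Nat :=
  match c, l1, r1 with
  | false, true, true => match l2, r2 with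
    | false, false => 200
    | true, true => 5500
    | _, _ => 2800
  | false, _, _ => 11000
  | true, true, true => match l2, r2 with
    | false, false => 3600
    | true, true => 10500
    | _, _ => 8600
  | true, false, false => 11000
  | true, false, true => cond r2 20000 11000
  | true, true, false => cond l2 20000 11000

/-- cell with sign `c`, magnitude at least `m`, clamp data `M` -/
def mkc (R : Nat) (c : Bool) (m M : Nat) : Cell :=
  cond c ⟨Nat.add 40000 m, Nat.add 40000 R, M⟩ ⟨Nat.sub 40000 R, Nat.sub 40000 m, M⟩

/-- additional restriction of the central cell -/
def ctr (zl zh : Nat) (j i : Nat) (c : Cell) : Cell :=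
  cond (Nat.beq i j) ⟨mx c.lo zl, mn c.hi zh, c.M⟩ c

def endc (R : Nat) : Cell := ⟨Nat.sub 40000 R, Nat.add 40000 R, 400000001⟩

def cells0 (R zl zh : Nat) (j i : Nat) : List Bool → List Cell
  | [] => [endc R]
  | c :: t => ctr zl zh j i (mkc R c 0 0) :: cells0 R zl zh j (Nat.succ i) t

def cells1 (R zl zh : Nat) (j i : Nat) : List Bool → List Cell
  | a :: b :: c :: d :: e :: t =>
     ctr zl zh j i (mkc R c (tab a b c d e) (Nat.add 1 (sq (tab a b c d e)))) ::
      cells1 R zl zh j (Nat.succ i) (b :: c :: d :: e :: t)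
  | _ :: _ :: c :: d :: [] => [mkc R c 0 400000001, mkc R d 0 400000001, endc R]
  | _ => []

def cells (mode : Bool) (R zl zh : Nat) (j : Nat) (w : List Bool) : List Cell :=
  match mode, w with
  | false, w => endc R :: cells0 R zl zh j 0 w
  | true, a :: b :: t => endc R :: mkc R a 0 400000001 :: mkc R b 0 400000001 ::
      cells1 R zl zh j 2 (a :: b :: t)
  | true, _ => []

def bad7 : List Bool → Bool
  | false :: false :: true :: _ :: true :: false :: false :: _ => true
  | _ => false

def bad : List Bool → Bool
  | [] => false
  | a :: t => bad7 (a :: t) || bad t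

def solve (mode skip : Bool) (A0 A1 R zl zh : Nat) : Nat → Nat → List Bool → Bool
  | 0, j, w => (skip && bad w) || contr A0 A1 6 (cells mode R zl zh j w)
  | n + 1, j, w => (skip && bad w) || contr A0 A1 6 (cells mode R zl zh j w) ||
      (solve mode skip A0 A1 R zl zh n (Nat.succ j) (false :: w ++ [false]) &&
       solve mode skip A0 A1 R zl zh n (Nat.succ j) (false :: w ++ [true]) &&
       solve mode skip A0 A1 R zl zh n (Nat.succ j) (true :: w ++ [false]) &&
       solve mode skip A0 A1 R zl zh n (Nat.succ j) (true :: w ++ [true]))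

def slic (mode skip : Bool) (A0 A1 R : Nat) (n : Nat) (j : Nat) (w : List Bool) (zl : Nat) : List Nat → Bool
  | [] => true
  | z :: t => solve mode skip A0 A1 R zl z n j w && slic mode skip A0 A1 R n j w z t

def all5 (f : Bool → Bool → Bool → Bool → Bool → Bool) : Bool :=
  [true, false].all fun a => [true, false].all fun b => [true, false].all fun c =>
    [true, false].all fun d => [true, false].all fun e => f a b c d e

def lowpts (m : Nat) (c : Bool) : List Nat :=
  cond c
    (if m = 3600 then [40000, 41200, 42400, 43600] else if m = 8600 then [40000, 44300, 48600] else
    if m = 10500 then [40000, 43500, 47000, 50500] else [40000, 40000 + m])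
    [40000 - m, 40000]

def lowOK (A0 A1 R : Nat) (a b c d e : Bool) : Bool :=
  match lowpts (tab a b c d e) c with
  | [] => false
  | z :: t => slic false true A0 A1 R 4 2 [a, b, c, d, e] z t

def clampOK (A0 A1 R : Nat) (a b c d e : Bool) : Bool :=
  let z := cond c (40000 + tab a b c d e) (40000 - tab a b c d e)
  solve true true A0 A1 R z z 4 2 [a, b, c, d, e]

def patOK (A0 A1 R : Nat) : Bool :=
  slic false false A0 A1 R 3 3 [false,false,true,false,true,false,false] (40000-R) [40000] &&
  slic false false A0 A1 R 3 3 [false,false,true,true,true,false,false] 40000 [41800, 43600, 40000+R]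
def chk (A0 A1 : Nat) : Bool := patOK A0 A1 35440 && (all5 (lowOK A0 A1 35440) && all5 (clampOK A0 A1 35440))

end HP

namespace HP

lemma mx_eq (a b : ℕ) : mx a b = max a b := by
  unfold mx; rcases h : Nat.ble a b <;> simp
  · have : ¬ a ≤ b := by rw [← Nat.ble_eq]; simp [h]
    omega
  · exact Nat.le_of_ble_eq_true h

lemma mn_eq (a b : ℕ) : mn a b = min a b := by
  unfold mn; rcases h : Nat.ble a b <;> simp
  · have : ¬ a ≤ b := by rw [← Nat.ble_eq]; simp [h]
    omega
  · exact Nat.le_of_ble_eq_true h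

lemma mx_le {a b : ℕ} {d : ℝ} (h1 : (a : ℝ) ≤ d) (h2 : (b : ℝ) ≤ d) : (mx a b : ℝ) ≤ d := by
  rw [mx_eq]; push_cast; exact max_le h1 h2

lemma le_mn {a b : ℕ} {d : ℝ} (h1 : d ≤ (a : ℝ)) (h2 : d ≤ (b : ℝ)) : d ≤ (mn a b : ℝ) := by
  rw [mn_eq]; push_cast; exact le_min h1 h2

lemma sub_ge (a b : ℕ) : (a : ℝ) - b ≤ (Nat.sub a b : ℕ) := by
  have h : a ≤ Nat.sub a b + b := by show a ≤ a - b + b; omega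
  have h2 : (a : ℝ) ≤ (Nat.sub a b : ℕ) + b := by exact_mod_cast h
  linarith

lemma sub_le' {a b : ℕ} {d : ℝ} (h0 : 0 ≤ d) (h : (a : ℝ) - b ≤ d) : ((Nat.sub a b : ℕ) : ℝ) ≤ d := by
  rcases le_total a b with h1 | h1
  · have : Nat.sub a b = 0 := Nat.sub_eq_zero_of_le h1
    rw [this]; simpa using h0
  · have : ((Nat.sub a b : ℕ) : ℝ) = a - b := Nat.cast_sub h1
    rw [this]; exact h

lemma sq_cast (a : ℕ) : ((sq a : ℕ) : ℝ) = (a : ℝ) ^ 2 := by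
  have : sq a = a ^ 2 := (pow_two a).symm
  rw [this]; push_cast; ring

lemma rup_sound {t v : ℕ} {d : ℝ} (hv : d ≤ v) (ht : d ^ 2 ≤ t) : d ≤ (rup t v : ℕ) := by
  unfold rup
  rcases h : Nat.ble (sq v) t with _ | _ <;> simp only [cond]
  · unfold rup1
    generalize nst3 t v = u
    rcases h' : Nat.ble t (sq u) with _ | _ <;> simp only [cond]
    · exact hv
    · refine le_mn ?_ hv
      have h2 : (t : ℝ) ≤ (sq u : ℕ) := by exact_mod_cast Nat.le_of_ble_eq_true h'
      rw [sq_cast] at h2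
      exact abs_le_of_sq_le_sq' (by linarith) (by positivity) |>.2
  · exact hv

lemma rdn_sound {t p v : ℕ} {d : ℝ} (hp : (p : ℝ) ≤ d) (ht : (t : ℝ) ≤ d ^ 2) : ((rdn t p v : ℕ) : ℝ) ≤ d := by
  have h0 : 0 ≤ d := le_trans (Nat.cast_nonneg _) hp
  unfold rdn
  rcases h : Nat.ble t (sq p) with _ | _ <;> simp only [cond]
  · unfold rdn1
    generalize Nat.div t (nst3 t v) = u
    rcases h' : Nat.ble (sq u) t with _ | _ <;> simp only [cond]
    · exact hp
    · refine mx_le ?_ hp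
      have h2 : ((sq u : ℕ) : ℝ) ≤ t := by exact_mod_cast Nat.le_of_ble_eq_true h'
      rw [sq_cast] at h2
      exact abs_le_of_sq_le_sq' (by linarith) (by positivity) |>.2
  · exact hp

def B (c : Cell) (v : ℝ) : Prop := (c.lo : ℝ) ≤ v ∧ v ≤ c.hi

def Ok (l c r : Cell) (vl vc vr : ℝ) (o : Option (Cell × Cell × Cell)) : Prop :=
  ∃ l' c' r', o = some (l', c', r') ∧ B l' vl ∧ B c' vc ∧ B r' vr ∧ l'.M = l.M ∧ c'.M = c.M ∧ r'.M = r.M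

lemma div_le_r (a : ℕ) : ((Nat.div a 10000 : ℕ) : ℝ) * 10000 ≤ a := by
  have : a / 10000 * 10000 ≤ a := Nat.div_mul_le_self _ _
  exact_mod_cast this

lemma le_div_r (a : ℕ) : (a : ℝ) ≤ ((Nat.add (Nat.div a 10000) 1 : ℕ) : ℝ) * 10000 := by
  have : a ≤ (a / 10000 + 1) * 10000 := by omega
  exact_mod_cast this

lemma le_of_not_blt {a b : ℕ} (h : Nat.blt a b = false) : b ≤ a := by
  by_contra hc
  have : Nat.blt a b = true := by rw [Nat.blt_eq]; omega
  simp [this] at h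

lemma fin_sound {A1 nl ls : ℕ} {l c r : Cell} {vl vc vr q : ℝ} (hl : B l vl) (hc : B c vc) (hr : B r vr)
    (h1 : (ls : ℝ) ≤ vl + vr) (hq : (nl : ℝ) ^ 2 ≤ q)
    (h2 : q < c.M ∨ 10000 * (vl + vr) + q ≤ 10000 * A1) :
    Ok l c r vl vc vr (fin A1 l r c nl ls) := by
  obtain ⟨hl1, hl2⟩ := hl
  obtain ⟨hr1, hr2⟩ := hr
  have hl0 : 0 ≤ vl := le_trans (Nat.cast_nonneg _) hl1
  have hr0 : 0 ≤ vr := le_trans (Nat.cast_nonneg _) hr1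
  unfold fin
  extract_lets rl ll hs w rh lh
  have e1 : (rl : ℝ) ≤ vr := mx_le hr1 (sub_le' hr0 (by linarith))
  have e2 : (ll : ℝ) ≤ vl := mx_le hl1 (sub_le' hl0 (by linarith))
  have e34 : vr ≤ rh ∧ vl ≤ lh := by
    rcases hw : w with _ | _
    · have hM := le_of_not_blt hw
      have hM' : (c.M : ℝ) ≤ (sq nl : ℕ) := by exact_mod_cast hM
      rw [sq_cast] at hM'
      have h3 : 10000 * (vl + vr) + q ≤ 10000 * A1 := by
        rcases h2 with h2 | h2
        · linarith
        · exact h2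
      have h4 := div_le_r (sq nl)
      rw [sq_cast] at h4
      have h5 : vl + vr ≤ (hs : ℝ) := le_trans (by linarith) (sub_ge A1 _)
      simp only [rh, lh, hw, cond]
      exact ⟨le_mn hr2 (le_trans (by linarith) (sub_ge hs ll)), le_mn hl2 (le_trans (by linarith) (sub_ge hs rl))⟩
    · simp only [rh, lh, hw, cond]; exact ⟨hr2, hl2⟩
  have e5 : Nat.ble rl rh = true := by
    rw [Nat.ble_eq]; exact_mod_cast e1.trans e34.1
  have e6 : Nat.ble ll lh = true := by
    rw [Nat.ble_eq]; exact_mod_cast e2.trans e34.2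
  rw [e5, e6]
  exact ⟨_, _, _, rfl, ⟨e2, e34.2⟩, hc, ⟨e1, e34.1⟩, rfl, rfl, rfl⟩

lemma tri_sound {A0 A1 : ℕ} {l c r : Cell} {vl vc vr : ℝ} (hl : B l vl) (hc : B c vc) (hr : B r vr)
    (h1 : 10000 * (A0 : ℝ) ≤ 10000 * (vl + vr) + (vc - 40000) ^ 2)
    (h2 : (vc - 40000) ^ 2 < c.M ∨ 10000 * (vl + vr) + (vc - 40000) ^ 2 ≤ 10000 * A1) :
    Ok l c r vl vc vr (tri A0 A1 l c r) := by
  have hl' := hl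
  have hr' := hr
  have hc' := hc
  obtain ⟨hl1, hl2⟩ := hl'
  obtain ⟨hr1, hr2⟩ := hr'
  obtain ⟨hc1, hc2⟩ := hc'
  have hl0 : 0 ≤ vl := le_trans (Nat.cast_nonneg _) hl1
  have hr0 : 0 ≤ vr := le_trans (Nat.cast_nonneg _) hr1
  have hc0 : 0 ≤ vc := le_trans (Nat.cast_nonneg _) hc1
  unfold tri
  extract_lets hb lb mp hp lp mq hq lq
  have hhb : (vc - 40000) ^ 2 ≤ (hb : ℝ) := by
    have : (hb : ℝ) = max ((Nat.mul 10000 (Nat.sub A1 (Nat.add l.lo r.lo)) : ℕ) : ℝ) (c.M : ℝ) := by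
      simp only [hb, mx_eq]; push_cast; rfl
    rw [this]
    rcases h2 with h2 | h2
    · exact le_max_of_le_right h2.le
    · apply le_max_of_le_left
      have e := sub_ge A1 (Nat.add l.lo r.lo)
      have e2 : ((Nat.add l.lo r.lo : ℕ) : ℝ) = l.lo + r.lo := Nat.cast_add _ _
      have e3 : ((Nat.mul 10000 (Nat.sub A1 (Nat.add l.lo r.lo)) : ℕ) : ℝ) = 10000 * (Nat.sub A1 (Nat.add l.lo r.lo) : ℕ) := by
        rw [show Nat.mul 10000 (Nat.sub A1 (Nat.add l.lo r.lo)) = 10000 * (Nat.sub A1 (Nat.add l.lo r.lo)) from rfl]; push_cast; ring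
      rw [e3]; rw [e2] at e; linarith
  have hlb : (lb : ℝ) ≤ (vc - 40000) ^ 2 := by
    have e2 : ((Nat.add l.hi r.hi : ℕ) : ℝ) = l.hi + r.hi := Nat.cast_add _ _
    have e3 : (lb : ℝ) = 10000 * (Nat.sub A0 (Nat.add l.hi r.hi) : ℕ) := by
        simp only [lb]; rw [show Nat.mul 10000 (Nat.sub A0 (Nat.add l.hi r.hi)) = 10000 * (Nat.sub A0 (Nat.add l.hi r.hi)) from rfl]; push_cast; ring
    rw [e3]
    have e4 : ((Nat.sub A0 (Nat.add l.hi r.hi) : ℕ) : ℝ) ≤ (vc - 40000) ^ 2 / 10000 :=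
      sub_le' (by positivity) (by rw [e2]; linarith)
    linarith
  have key : ∀ nl nh : ℕ, (nl : ℝ) ^ 2 ≤ (vc - 40000) ^ 2 → (vc - 40000) ^ 2 ≤ (nh : ℝ) ^ 2 →
      ((Nat.sub A0 (Nat.add (Nat.div (sq nh) 10000) 1) : ℕ) : ℝ) ≤ vl + vr := by
    intro nl nh _ h
    refine sub_le' (by linarith) ?_
    have := le_div_r (sq nh)
    rw [sq_cast] at this
    linarith
  rcases hs : Nat.ble 40000 c.lo with _ | _ <;> simp only [cond]
  · rcases hs' : Nat.ble c.hi 40000 with _ | _ <;> simp only []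
    · exact ⟨_, _, _, rfl, hl, hc, hr, rfl, rfl, rfl⟩
    · have hs2 : (c.hi : ℝ) ≤ 40000 := by exact_mod_cast Nat.le_of_ble_eq_true hs'
      have hd : 0 ≤ 40000 - vc := by linarith
      have q1 : (40000 - vc) ^ 2 = (vc - 40000) ^ 2 := by ring
      have f1 : 40000 - vc ≤ (hq : ℕ) :=
        rup_sound (le_trans (by push_cast; linarith) (sub_ge 40000 c.lo)) (by rw [q1]; exact hhb)
      have f2 : (lq : ℝ) ≤ 40000 - vc :=
        rdn_sound (sub_le' hd (by push_cast; linarith)) (by rw [q1]; exact hlb)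
      clear_value hq lq; clear hs2; obtain ⟨nh, rfl⟩ : ∃ nh, nh = hq := ⟨_, rfl⟩
      obtain ⟨nl, rfl⟩ : ∃ nl, nl = lq := ⟨_, rfl⟩
      have f3 : Nat.ble nl nh = true := by rw [Nat.ble_eq]; exact_mod_cast f2.trans f1
      rw [f3]
      have n0 : (0 : ℝ) ≤ nl := Nat.cast_nonneg _
      have g1 : (nl : ℝ) ^ 2 ≤ (vc - 40000) ^ 2 := by nlinarith
      have g2 : (vc - 40000) ^ 2 ≤ (nh : ℝ) ^ 2 := by nlinarith
      exact fin_sound (c := ⟨Nat.sub 40000 nh, Nat.sub 40000 nl, c.M⟩) hl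
        ⟨sub_le' hc0 (by push_cast; linarith), le_trans (by push_cast; linarith) (sub_ge _ _)⟩ hr (key nl nh g1 g2) g1 h2
  · have hs2 : (40000 : ℝ) ≤ c.lo := by exact_mod_cast Nat.le_of_ble_eq_true hs
    have hd : 0 ≤ vc - 40000 := by linarith
    have f1 : vc - 40000 ≤ (hp : ℕ) :=
      rup_sound (le_trans (by push_cast; linarith) (sub_ge c.hi 40000)) hhb
    have f2 : (lp : ℝ) ≤ vc - 40000 :=
      rdn_sound (sub_le' hd (by push_cast; linarith)) hlb
    clear_value hp lp; clear hs2; obtain ⟨nh, rfl⟩ : ∃ nh, nh = hp := ⟨_, rfl⟩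
    obtain ⟨nl, rfl⟩ : ∃ nl, nl = lp := ⟨_, rfl⟩
    have f3 : Nat.ble nl nh = true := by rw [Nat.ble_eq]; exact_mod_cast f2.trans f1
    rw [f3]
    have n0 : (0 : ℝ) ≤ nl := Nat.cast_nonneg _
    have g1 : (nl : ℝ) ^ 2 ≤ (vc - 40000) ^ 2 := by nlinarith
    have g2 : (vc - 40000) ^ 2 ≤ (nh : ℝ) ^ 2 := by nlinarith
    exact fin_sound (c := ⟨Nat.add 40000 nl, Nat.add 40000 nh, c.M⟩) hl
        ⟨by rw [show ((Nat.add 40000 nl : ℕ) : ℝ) = 40000 + nl from by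
              rw [show Nat.add 40000 nl = 40000 + nl from rfl]; push_cast; ring]; linarith,
         by rw [show ((Nat.add 40000 nh : ℕ) : ℝ) = 40000 + nh from by
              rw [show Nat.add 40000 nh = 40000 + nh from rfl]; push_cast; ring]; linarith⟩ hr (key nl nh g1 g2) g1 h2

end HP

namespace HP

def Sat (A1 : ℕ) (V : ℤ → ℝ) (k : ℤ) (c : Cell) : Prop :=
  B c (V k) ∧ ((V k - 40000) ^ 2 < c.M ∨ 10000 * (V (k - 1) + V (k + 1)) + (V k - 40000) ^ 2 ≤ 10000 * A1)

def Good (A0 : ℕ) (V : ℤ → ℝ) : Prop :=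
  ∀ k, 10000 * (A0 : ℝ) ≤ 10000 * (V (k - 1) + V (k + 1)) + (V k - 40000) ^ 2

def rev (V : ℤ → ℝ) : ℤ → ℝ := fun k => V (-k)

def In (A1 : ℕ) (V : ℤ → ℝ) : ℤ → List Cell → Prop
  | _, [] => True
  | k, c :: t => Sat A1 V k c ∧ In A1 V (k + 1) t

lemma rev_good {A0 : ℕ} {V : ℤ → ℝ} (h : Good A0 V) : Good A0 (rev V) := by
  intro k
  have := h (-k)
  simp only [rev]
  rw [show -(k - 1) = -k + 1 by ring, show -(k + 1) = -k - 1 by ring]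
  linarith

lemma rev_sat {A1 : ℕ} {V : ℤ → ℝ} {k : ℤ} {c : Cell} (h : Sat A1 V k c) : Sat A1 (rev V) (-k) c := by
  unfold Sat at *
  simp only [rev]
  rw [show -(-k - 1) = k + 1 by ring, show -(-k + 1) = k - 1 by ring, neg_neg, add_comm (V (k + 1))]
  exact h

lemma sat_upd {A1 : ℕ} {V : ℤ → ℝ} {k : ℤ} {c c' : Cell} (h : Sat A1 V k c) (hb : B c' (V k))
    (hM : c'.M = c.M) : Sat A1 V k c' := ⟨hb, by rw [hM]; exact h.2⟩

lemma sweep_sound {A0 A1 : ℕ} {V : ℤ → ℝ} (hV : Good A0 V) : ∀ (t : List Cell) (acc : List Cell) (l c : Cell) (k : ℤ),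
    In A1 (rev V) (2 - k) acc → Sat A1 V (k - 1) l → Sat A1 V k c → In A1 V (k + 1) t →
    ∃ b k', sweep A0 A1 acc l c t = some b ∧ In A1 (rev V) k' b
  | [], acc, l, c, k, ha, hl, hc, _ => by
    refine ⟨_, -k, rfl, rev_sat hc, ?_⟩
    have := rev_sat hl
    rw [show -k + 1 = -(k - 1) by ring]
    refine ⟨this, ?_⟩
    rw [show -(k - 1) + 1 = 2 - k by ring]
    exact ha
  | r :: t, acc, l, c, k, ha, hl, hc, ht => by
    obtain ⟨l', c', r', e, hl', hc', hr', ml, mc, mr⟩ := tri_sound (A1 := A1) hl.1 hc.1 ht.1.1 (hV k) hc.2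
    simp only [sweep, e]
    refine sweep_sound hV t (l' :: acc) c' r' (k + 1) ?_ ?_ ?_ ?_
    · have := rev_sat (sat_upd hl hl' ml)
      rw [show 2 - (k + 1) = -(k - 1) by ring]
      refine ⟨this, ?_⟩
      rw [show -(k - 1) + 1 = 2 - k by ring]
      exact ha
    · rw [show k + 1 - 1 = k by ring]; exact sat_upd hc hc' mc
    · exact sat_upd ht.1 hr' mr
    · exact ht.2

lemma contr_sound {A0 A1 : ℕ} : ∀ (n : ℕ) (b : List Cell) (V : ℤ → ℝ) (k : ℤ), Good A0 V → In A1 V k b →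
    contr A0 A1 n b = false
  | 0, _, _, _, _, _ => rfl
  | n + 1, [], _, _, _, _ => rfl
  | n + 1, [_], _, _, _, _ => rfl
  | n + 1, l :: c :: t, V, k, hV, h => by
    obtain ⟨b, k', e, hb⟩ := sweep_sound (A1 := A1) hV t [] l c (k + 1) trivial
      (by rw [add_sub_cancel_right]; exact h.1) h.2.1 h.2.2
    simp only [contr, e]
    exact contr_sound n b (rev V) k' (rev_good hV) hb

def Mt (s : ℤ → Bool) : ℤ → List Bool → Prop
  | _, [] => True
  | k, c :: t => s k = c ∧ Mt s (k + 1) t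

/-- the clamp table along a code -/
def mw (s : ℤ → Bool) (k : ℤ) : ℕ := tab (s (k - 2)) (s (k - 1)) (s k) (s (k + 1)) (s (k + 2))

structure Env (mode : Bool) (A0 A1 R : ℕ) (V : ℤ → ℝ) (s : ℤ → Bool) : Prop where
  good : Good A0 V
  lo : ∀ k, 40000 - (R : ℝ) ≤ V k
  hi : ∀ k, V k ≤ 40000 + (R : ℝ)
  up : ∀ k, s k = true → 40000 ≤ V k
  dn : ∀ k, s k = false → V k ≤ 40000
  c0 : mode = false → ∀ k, 10000 * (V (k - 1) + V (k + 1)) + (V k - 40000) ^ 2 ≤ 10000 * A1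
  c1 : mode = true → ∀ k, (V k - 40000) ^ 2 ≤ (mw s k : ℝ) ^ 2 ∨
    10000 * (V (k - 1) + V (k + 1)) + (V k - 40000) ^ 2 ≤ 10000 * A1
  up1 : mode = true → ∀ k, s k = true → 40000 + (mw s k : ℝ) ≤ V k
  dn1 : mode = true → ∀ k, s k = false → V k ≤ 40000 - (mw s k : ℝ)

lemma tab_le (a b c d e : Bool) : tab a b c d e ≤ 20000 := by
  revert a b c d e; decide

lemma add_cast (a b : ℕ) : ((Nat.add a b : ℕ) : ℝ) = a + b := Nat.cast_add a b

section
variable {mode : Bool} {A0 A1 R : ℕ} {V : ℤ → ℝ} {s : ℤ → Bool}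

lemma Env.V0 (E : Env mode A0 A1 R V s) (hR : R ≤ 40000) (k : ℤ) : 0 ≤ V k := by
  have h1 : (R : ℝ) ≤ 40000 := by exact_mod_cast hR
  have := E.lo k
  linarith

lemma Env.gen (E : Env mode A0 A1 R V s) (k : ℤ) : (V k - 40000) ^ 2 < (400000001 : ℕ) ∨
    10000 * (V (k - 1) + V (k + 1)) + (V k - 40000) ^ 2 ≤ 10000 * A1 := by
  rcases hm : mode with _ | _
  · exact Or.inr (E.c0 hm k)
  · rcases E.c1 hm k with h | h
    · left
      have h1 : (mw s k : ℝ) ≤ 20000 := by exact_mod_cast tab_le _ _ _ _ _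
      have h0 : (0 : ℝ) ≤ mw s k := Nat.cast_nonneg _
      push_cast
      nlinarith
    · exact Or.inr h

lemma Env.endc (E : Env mode A0 A1 R V s) (hR : R ≤ 40000) (k : ℤ) : Sat A1 V k (endc R) := by
  refine ⟨⟨sub_le' (E.V0 hR k) (by push_cast; exact E.lo k), ?_⟩, E.gen k⟩
  have := E.hi k
  simp only [HP.endc]; rw [add_cast]; push_cast; linarith

lemma Env.mkc (E : Env mode A0 A1 R V s) (hR : R ≤ 40000) (k : ℤ) {m M : ℕ}
    (hM : (V k - 40000) ^ 2 < M ∨ 10000 * (V (k - 1) + V (k + 1)) + (V k - 40000) ^ 2 ≤ 10000 * A1)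
    (h1 : s k = true → 40000 + (m : ℝ) ≤ V k) (h2 : s k = false → V k ≤ 40000 - (m : ℝ)) :
    Sat A1 V k (HP.mkc R (s k) m M) := by
  rcases hs : s k with _ | _ <;> simp only [HP.mkc, cond]
  · refine ⟨⟨sub_le' (E.V0 hR k) (by push_cast; exact E.lo k), ?_⟩, hM⟩
    exact le_trans (h2 hs) (le_trans (by push_cast; linarith) (sub_ge 40000 m))
  · refine ⟨⟨?_, ?_⟩, hM⟩
    · simp only []; rw [add_cast]; push_cast; exact h1 hs
    · simp only []; rw [add_cast]; push_cast; exact E.hi k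

lemma Env.unk (E : Env mode A0 A1 R V s) (hR : R ≤ 40000) (k : ℤ) : Sat A1 V k (HP.mkc R (s k) 0 400000001) :=
  E.mkc hR k (E.gen k) (fun h => by push_cast; linarith [E.up k h]) (fun h => by push_cast; linarith [E.dn k h])

lemma ctr_sound {zl zh j i : ℕ} {k n : ℤ} {c : Cell} (hk : k = n - j + i) (hc : Sat A1 V k c)
    (h1 : (zl : ℝ) ≤ V n) (h2 : V n ≤ zh) : Sat A1 V k (ctr zl zh j i c) := by
  unfold ctr
  rcases h : Nat.beq i j with _ | _ <;> simp only [cond]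
  · exact hc
  · have : i = j := Nat.eq_of_beq_eq_true h
    have hkn : k = n := by rw [hk, this]; ring
    refine ⟨⟨mx_le hc.1.1 (by rw [hkn]; exact h1), le_mn hc.1.2 (by rw [hkn]; exact h2)⟩, hc.2⟩

lemma cells0_sound (E : Env false A0 A1 R V s) (hR : R ≤ 40000) {zl zh j : ℕ} {n : ℤ}
    (h1 : (zl : ℝ) ≤ V n) (h2 : V n ≤ zh) : ∀ (w : List Bool) (i : ℕ) (k : ℤ), k = n - j + i → Mt s k w →
    In A1 V k (cells0 R zl zh j i w)
  | [], _, k, _, _ => ⟨E.endc hR k, trivial⟩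
  | c :: t, i, k, hk, hw => by
    obtain ⟨rfl, ht⟩ := hw
    refine ⟨ctr_sound hk (E.mkc hR k (Or.inr (E.c0 rfl k)) (fun h => ?_) (fun h => ?_)) h1 h2,
      cells0_sound E hR h1 h2 t (i + 1) (k + 1) (by rw [hk]; push_cast; ring) ht⟩
    · push_cast; linarith [E.up k h]
    · push_cast; linarith [E.dn k h]

lemma cells1_sound (E : Env true A0 A1 R V s) (hR : R ≤ 40000) {zl zh j : ℕ} {n : ℤ}
    (h1 : (zl : ℝ) ≤ V n) (h2 : V n ≤ zh) : ∀ (w : List Bool) (i : ℕ) (k : ℤ), k = n - j + i → Mt s (k - 2) w →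
    In A1 V k (cells1 R zl zh j i w)
  | a :: b :: c :: d :: e :: t, i, k, hk, hw => by
    have hw' := hw
    obtain ⟨ha, hb, hc, hd, he, ht⟩ := hw'
    have hm : tab a b c d e = mw s k := by
      rw [← ha, ← hb, ← hc, ← hd, ← he]
      simp only [mw]
      ring_nf
    have hck : c = s k := by rw [← hc]; ring_nf
    rw [cells1, hm, hck]
    refine ⟨ctr_sound hk (E.mkc hR k ?_ (E.up1 rfl k) (E.dn1 rfl k)) h1 h2,
      ?_⟩
    · refine (E.c1 rfl k).imp (fun h => ?_) id
      rw [add_cast, sq_cast]; push_cast; linarith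
    · have := cells1_sound E hR h1 h2 (b :: c :: d :: e :: t) (i + 1) (k + 1) (by rw [hk]; push_cast; ring)
        (by rw [show k + 1 - 2 = k - 2 + 1 by ring]; exact hw.2)
      rw [hck] at this
      exact this
  | [a, b, c, d], i, k, hk, hw => by
    obtain ⟨-, -, hc, hd, -⟩ := hw
    rw [show k - 2 + 1 + 1 = k by ring] at hc hd
    rw [← hc, ← hd]
    exact ⟨E.unk hR k, E.unk hR _, E.endc hR _, trivial⟩
  | [], _, _, _, _ => trivial
  | [_], _, _, _, _ => trivial
  | [_, _], _, _, _, _ => trivial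
  | [_, _, _], _, _, _, _ => trivial

lemma cells_sound (E : Env mode A0 A1 R V s) (hR : R ≤ 40000) {zl zh j : ℕ} {n : ℤ}
    (h1 : (zl : ℝ) ≤ V n) (h2 : V n ≤ zh) (w : List Bool) (hw : Mt s (n - j) w) :
    In A1 V (n - j - 1) (cells mode R zl zh j w) := by
  match mode, w, E, hw with
  | false, w, E, hw =>
    refine ⟨E.endc hR _, ?_⟩
    rw [sub_add_cancel]
    exact cells0_sound E hR h1 h2 w 0 _ (by push_cast; ring) hw
  | true, [], _, _ => trivial
  | true, [_], _, _ => trivial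
  | true, a :: b :: t, E, hw =>
    have hw' := hw
    obtain ⟨ha, hb, -⟩ := hw'
    refine ⟨E.endc hR _, ?_⟩
    rw [sub_add_cancel]
    rw [← ha, ← hb]
    refine ⟨E.unk hR _, E.unk hR _, ?_⟩
    refine cells1_sound E hR h1 h2 _ 2 _ (by push_cast; ring) ?_
    rw [show n - (j : ℤ) + 1 + 1 - 2 = n - j by ring, ha, hb]
    exact hw

/-- no forbidden word -/
def Adm (s : ℤ → Bool) : Prop := ∀ k, ¬ (s k = false ∧ s (k + 1) = false ∧ s (k + 2) = true ∧
  s (k + 4) = true ∧ s (k + 5) = false ∧ s (k + 6) = false)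

lemma bad7_sound (hs : Adm s) : ∀ (w : List Bool) (k : ℤ), Mt s k w → bad7 w = false := by
  intro w k h
  unfold bad7
  split
  · exfalso
    obtain ⟨h0, h1, h2, -, h4, h5, h6, -⟩ := h
    apply hs k
    refine ⟨h0, h1, ?_, ?_, ?_, ?_⟩
    · rw [← h2]; ring_nf
    · rw [← h4]; ring_nf
    · rw [← h5]; ring_nf
    · rw [← h6]; ring_nf
  · rfl

lemma bad_sound (hs : Adm s) : ∀ (w : List Bool) (k : ℤ), Mt s k w → bad w = false
  | [], _, _ => rfl
  | a :: t, k, h => by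
    simp only [bad, bad7_sound hs _ k h, bad_sound hs t (k + 1) h.2, Bool.or_false]

lemma Mt_append : ∀ (w : List Bool) (k : ℤ), Mt s k w → ∀ y, s (k + w.length) = y → Mt s k (w ++ [y])
  | [], k, _, y, hy => ⟨by simpa using hy, trivial⟩
  | a :: t, k, h, y, hy => ⟨h.1, Mt_append t (k + 1) h.2 y (by
      rw [← hy]; push_cast [List.length_cons]; ring_nf)⟩

lemma solve_sound {skip : Bool} (E : Env mode A0 A1 R V s) (hR : R ≤ 40000) (hs : skip = true → Adm s)
    {zl zh : ℕ} {n : ℤ}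
    (h1 : (zl : ℝ) ≤ V n) (h2 : V n ≤ zh) : ∀ (f j : ℕ) (w : List Bool), Mt s (n - j) w →
    solve mode skip A0 A1 R zl zh f j w = false := by
  have base : ∀ (j : ℕ) (w : List Bool), Mt s (n - j) w →
      ((skip && bad w) || contr A0 A1 6 (cells mode R zl zh j w)) = false := by
    intro j w hw
    rw [contr_sound 6 _ V _ E.good (cells_sound E hR h1 h2 w hw), Bool.or_false]
    rcases hk : skip with _ | _
    · rfl
    · rw [bad_sound (hs hk) w _ hw]; rfl
  intro f
  induction f with
  | zero => intro j w hw; exact base j w hw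
  | succ f ih =>
    intro j w hw
    rw [solve, base j w hw, Bool.false_or]
    have key : solve mode skip A0 A1 R zl zh f (Nat.succ j)
        (s (n - (j + 1 : ℕ)) :: w ++ [s (n - j + w.length)]) = false := by
      apply ih
      refine ⟨rfl, Mt_append w _ ?_ _ ?_⟩
      · rw [show n - ((j + 1 : ℕ) : ℤ) + 1 = n - j by push_cast; ring]; exact hw
      · push_cast; ring_nf
    generalize s (n - (j + 1 : ℕ)) = x at key
    generalize s (n - j + w.length) = y at key
    cases x <;> cases y <;> rw [key] <;> simp

lemma slic_sound {skip : Bool} (E : Env mode A0 A1 R V s) (hR : R ≤ 40000) (hs : skip = true → Adm s)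
    {n : ℤ} {f j : ℕ} {w : List Bool} (hw : Mt s (n - j) w) : ∀ (l : List ℕ) (zl : ℕ),
    slic mode skip A0 A1 R f j w zl l = true → (zl : ℝ) ≤ V n → ∀ z ∈ l, ¬ V n ≤ z
  | [], _, _, _, z, hz => by simp at hz
  | z0 :: t, zl, h, h1, z, hz => by
    rw [slic, Bool.and_eq_true] at h
    have h3 : ¬ V n ≤ z0 := by
      intro h4
      rw [solve_sound E hR hs h1 h4 f j w hw] at h
      simp at h
    rcases List.mem_cons.1 hz with rfl | hz
    · exact h3
    · exact slic_sound E hR hs hw t z0 h.2 (not_le.1 h3).le z hz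

end
end HP

namespace HP

lemma chk1 : chk 133124 133401 = true := by decide +kernel
lemma chk2 : chk 133400 133801 = true := by decide +kernel
lemma chk3 : chk 133800 134301 = true := by decide +kernel
lemma chk4 : chk 134300 134690 = true := by decide +kernel

lemma all5_sound {f : Bool → Bool → Bool → Bool → Bool → Bool} (h : all5 f = true) (a b c d e : Bool) :
    f a b c d e = true := by
  simp only [all5, List.all_cons, List.all_nil, Bool.and_true, Bool.and_eq_true] at h
  revert a b c d e
  simp only [Bool.forall_bool]
  tauto

section
variable {mode : Bool} {A0 A1 : ℕ} {V : ℤ → ℝ} {s : ℤ → Bool}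

lemma Mt5 (s : ℤ → Bool) (n : ℤ) : Mt s (n - (2 : ℕ)) [s (n - 2), s (n - 1), s n, s (n + 1), s (n + 2)] := by
  refine ⟨by push_cast; rfl, ?_, ?_, ?_, ?_, trivial⟩ <;> · push_cast; ring_nf

lemma adm_of (h : patOK A0 A1 35440 = true) (E : Env false A0 A1 35440 V s) : Adm s := by
  rintro k ⟨h0, h1, h2, h4, h5, h6⟩
  rw [patOK, Bool.and_eq_true] at h
  have hw : ∀ c, s (k + 3) = c → Mt s ((k + 3) - (3 : ℕ)) [false, false, true, c, true, false, false] := by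
    intro c hc
    rw [show k + 3 - ((3 : ℕ) : ℤ) = k by push_cast; ring]
    refine ⟨h0, h1, ?_, ?_, ?_, ?_, ?_, trivial⟩
    · rw [← h2]; ring_nf
    · rw [← hc]; ring_nf
    · rw [← h4]; ring_nf
    · rw [← h5]; ring_nf
    · rw [← h6]; ring_nf
  rcases hc : s (k + 3) with _ | _
  · refine slic_sound E (by norm_num) (by simp) (hw _ hc) _ _ h.1 ?_ 40000 (by simp) ?_
    · have := E.lo (k + 3); norm_num at this ⊢; linarith
    · have := E.dn _ hc; push_cast; linarith
  · refine slic_sound E (by norm_num) (by simp) (hw _ hc) _ _ h.2 ?_ (40000 + 35440) (by simp) ?_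
    · have := E.up _ hc; push_cast; linarith
    · have := E.hi (k + 3); push_cast at this ⊢; linarith

lemma lowpts_spec (a b c d e : Bool) : ∃ z t, lowpts (tab a b c d e) c = z :: t ∧
    (c = true → z = 40000 ∧ 40000 + tab a b c d e ∈ t) ∧ (c = false → z = 40000 - tab a b c d e ∧ 40000 ∈ t) := by
  revert a b c d e
  simp only [Bool.forall_bool]
  simp [lowpts, tab]

lemma low_of (h : all5 (lowOK A0 A1 35440) = true) (E : Env false A0 A1 35440 V s) (hs : Adm s) (n : ℤ) :
    (s n = true → 40000 + (mw s n : ℝ) ≤ V n) ∧ (s n = false → V n ≤ 40000 - (mw s n : ℝ)) := by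
  have h1 := all5_sound h (s (n - 2)) (s (n - 1)) (s n) (s (n + 1)) (s (n + 2))
  obtain ⟨z, t, hz, ht, hf⟩ := lowpts_spec (s (n - 2)) (s (n - 1)) (s n) (s (n + 1)) (s (n + 2))
  rw [lowOK, hz] at h1
  change slic false true A0 A1 35440 4 2 _ z t = true at h1
  have key := slic_sound E (by norm_num) (fun _ => hs) (Mt5 s n) t z h1
  have hle := tab_le (s (n - 2)) (s (n - 1)) (s n) (s (n + 1)) (s (n + 2))
  constructor
  · intro hn
    obtain ⟨e1, e2⟩ := ht hn
    have := key (by rw [e1]; push_cast; exact E.up n hn) _ e2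
    push_cast at this
    exact (not_le.1 this).le
  · intro hn
    obtain ⟨e1, e2⟩ := hf hn
    by_contra hc
    refine key ?_ _ e2 (by push_cast; exact E.dn n hn)
    rw [e1, Nat.cast_sub (by omega)]
    push_cast
    exact (not_le.1 hc).le

lemma clamp_of (h : all5 (clampOK A0 A1 35440) = true) (E : Env true A0 A1 35440 V s) (hs : Adm s) (n : ℤ) :
    (V n - 40000) ^ 2 ≠ (mw s n : ℝ) ^ 2 := by
  intro he
  have h1 := all5_sound h (s (n - 2)) (s (n - 1)) (s n) (s (n + 1)) (s (n + 2))
  have hle := tab_le (s (n - 2)) (s (n - 1)) (s n) (s (n + 1)) (s (n + 2))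
  have h0 : (0 : ℝ) ≤ mw s n := Nat.cast_nonneg _
  rw [clampOK] at h1
  set z := (bif s n then 40000 + tab (s (n - 2)) (s (n - 1)) (s n) (s (n + 1)) (s (n + 2)) else 40000 - tab (s (n - 2)) (s (n - 1)) (s n) (s (n + 1)) (s (n + 2))) with hzd
  have hz : (z : ℝ) = V n := by
    rcases hn : s n with _ | _
    · have hd := E.dn1 rfl n hn
      have hz : z = 40000 - mw s n := by
        simp only [hzd, mw, hn, cond]
      have : V n - 40000 = - (mw s n : ℝ) := by
        rcases sq_eq_sq_iff_eq_or_eq_neg.1 he with h | h <;> linarith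
      rw [hz, Nat.cast_sub (by unfold mw; omega)]; push_cast; linarith
    · have hd := E.up1 rfl n hn
      have hz : z = 40000 + mw s n := by
        simp only [hzd, mw, hn, cond]
      have : V n - 40000 = (mw s n : ℝ) := by
        rcases sq_eq_sq_iff_eq_or_eq_neg.1 he with h | h <;> linarith
      rw [hz]; push_cast; linarith
  have := solve_sound (skip := true) E (by norm_num) (fun _ => hs) hz.le hz.ge 4 2 _ (Mt5 s n)
  rw [this] at h1
  simp at h1

end

/-- parameter region -/
def Par (a b : ℝ) : Prop := 5.31245 < a ∧ a < 5.46885 ∧ 1 - 1 / 1000000 < b ∧ b < 1 + 1 / 1000000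

noncomputable def mr (s : ℤ → Bool) (n : ℤ) : ℝ := (mw s n : ℝ) / 10000

lemma piece {a b : ℝ} (h : Par a b) : ∃ A0 A1 : ℕ, chk A0 A1 = true ∧ ∀ x : ℝ, |x| ≤ 3.544 →
    (A0 : ℝ) ≤ 10000 * (a - (b - 1) * x) + 80000 ∧ 10000 * (a - (b - 1) * x) + 80000 ≤ A1 := by
  obtain ⟨h1, h2, h3, h4⟩ := h
  have key : ∀ x : ℝ, |x| ≤ 3.544 → |(b - 1) * x| ≤ 0.000004 := by
    intro x hx
    rw [abs_mul]
    have : |b - 1| ≤ 1 / 1000000 := abs_le.2 ⟨by linarith, by linarith⟩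
    have := mul_le_mul this hx (abs_nonneg _) (by norm_num)
    refine this.trans (by norm_num)
  rcases le_total a 5.34005 with g1 | g1
  · refine ⟨_, _, chk1, fun x hx => ?_⟩
    have := abs_le.1 (key x hx); push_cast; constructor <;> linarith
  rcases le_total a 5.38005 with g2 | g2
  · refine ⟨_, _, chk2, fun x hx => ?_⟩
    have := abs_le.1 (key x hx); push_cast; constructor <;> linarith
  rcases le_total a 5.43005 with g3 | g3
  · refine ⟨_, _, chk3, fun x hx => ?_⟩
    have := abs_le.1 (key x hx); push_cast; constructor <;> linarith
  · refine ⟨_, _, chk4, fun x hx => ?_⟩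
    have := abs_le.1 (key x hx); push_cast; constructor <;> linarith

theorem engA {a b : ℝ} (h : Par a b) {x : ℤ → ℝ} (hx : ∀ n, |x n| ≤ 3.544)
    (ho : ∀ n, x (n + 1) + b * x (n - 1) = a - x n ^ 2) {s : ℤ → Bool} (hs1 : ∀ n, s n = true → 0 ≤ x n)
    (hs0 : ∀ n, s n = false → x n ≤ 0) :
    Adm s ∧ ∀ n, (s n = true → mr s n ≤ x n) ∧ (s n = false → x n ≤ - mr s n) := by
  obtain ⟨A0, A1, hc, hA⟩ := piece h
  rw [chk, Bool.and_eq_true, Bool.and_eq_true] at hc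
  have he : ∀ k, (10000 * x k + 40000 - 40000) ^ 2 = 100000000 * x k ^ 2 := fun k => by ring
  have E : Env false A0 A1 35440 (fun n => 10000 * x n + 40000) s := by
    refine ⟨fun k => ?_, fun k => ?_, fun k => ?_, fun k hk => ?_, fun k hk => ?_, fun _ k => ?_,
      by simp, by simp, by simp⟩
    · have := (hA (x (k - 1)) (hx _)).1; have := ho k; have := he k; linarith
    · have := abs_le.1 (hx k); push_cast; linarith
    · have := abs_le.1 (hx k); push_cast; linarith
    · have := hs1 k hk; linarith
    · have := hs0 k hk; linarith
    · have := (hA (x (k - 1)) (hx _)).2; have := ho k; have := he k; linarith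
  have ha := adm_of hc.1 E
  refine ⟨ha, fun n => ?_⟩
  have := low_of hc.2.1 E ha n
  unfold mr
  refine ⟨fun hn => ?_, fun hn => ?_⟩
  · have := this.1 hn; linarith
  · have := this.2 hn; linarith

theorem engC {a b : ℝ} (h : Par a b) {x : ℤ → ℝ} (hx : ∀ n, |x n| ≤ 3.544) {s : ℤ → Bool} (hs : Adm s)
    (ho : ∀ n, x n ^ 2 = max (a - x (n + 1) - b * x (n - 1)) (mr s n ^ 2))
    (hs1 : ∀ n, s n = true → mr s n ≤ x n)
    (hs0 : ∀ n, s n = false → x n ≤ - mr s n) : ∀ n, x (n + 1) + b * x (n - 1) = a - x n ^ 2 := by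
  obtain ⟨A0, A1, hc, hA⟩ := piece h
  rw [chk, Bool.and_eq_true, Bool.and_eq_true] at hc
  have hm : ∀ k, (mw s k : ℝ) = 10000 * mr s k := fun k => by unfold mr; ring
  have hm0 : ∀ k, 0 ≤ mr s k := fun k => by unfold mr; positivity
  have he : ∀ k, (10000 * x k + 40000 - 40000) ^ 2 = 100000000 * x k ^ 2 := fun k => by ring
  have E : Env true A0 A1 35440 (fun n => 10000 * x n + 40000) s := by
    refine ⟨fun k => ?_, fun k => ?_, fun k => ?_, fun k hk => ?_, fun k hk => ?_, by simp, fun _ k => ?_,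
      fun _ k hk => ?_, fun _ k hk => ?_⟩
    · have := (hA (x (k - 1)) (hx _)).1
      have := (le_max_left (a - x (k + 1) - b * x (k - 1)) (mr s k ^ 2)).trans (ho k).ge
      have := he k; linarith
    · have := abs_le.1 (hx k); push_cast; linarith
    · have := abs_le.1 (hx k); push_cast; linarith
    · have := hs1 k hk; have := hm0 k; linarith
    · have := hs0 k hk; have := hm0 k; linarith
    · rw [hm]
      have h1 := (hA (x (k - 1)) (hx _)).2
      have h2 := ho k
      rcases max_cases (a - x (k + 1) - b * x (k - 1)) (mr s k ^ 2) with ⟨h3, _⟩ | ⟨h3, _⟩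
      · rw [h3] at h2; right; have := he k; linarith
      · rw [h3] at h2; left; have := he k; linarith
    · have := hs1 k hk; rw [hm]; linarith
    · have := hs0 k hk; rw [hm]; linarith
  intro n
  have h1 := clamp_of hc.2.2 E hs n
  rw [hm] at h1
  have h2 := ho n
  rcases max_cases (a - x (n + 1) - b * x (n - 1)) (mr s n ^ 2) with ⟨h3, _⟩ | ⟨h3, _⟩
  · rw [h3] at h2; linarith
  · rw [h3] at h2; exact absurd (by have := he n; linarith) h1

end HP

namespace HP

/-- weights times `100` -/
def wt (l2 l1 c r1 r2 : Bool) : ℕ :=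
  if c && l1 && r1 then (if l2 || r2 then 200 else 285) else 100

def ww (s : ℤ → Bool) (k : ℤ) : ℕ := wt (s (k - 2)) (s (k - 1)) (s k) (s (k + 1)) (s (k + 2))

noncomputable def wr (s : ℤ → Bool) (k : ℤ) : ℝ := (ww s k : ℝ) / 100

def isZ (s : ℤ → Bool) (n : ℤ) : Bool := !(s n) && s (n - 1) && s (n + 1)

lemma wt_tab : ∀ a b c d e f g : Bool, (!d && c && e) = false →
    1000 * 100 * 100 * (wt c d e f g + wt a b c d e) ≤ 979 * wt b c d e f * (2 * tab b c d e f) := by decide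

/-- `σp * (W_u - 0.98) ≤ Q` for `σp ≤ 1 / (2 m)` -/
lemma side_tab : ∀ a q e f : Bool,
    100 * wt false true q e f ≤ 9799 + (cond q 4680 95) * tab a false true q e * 2 / 10000 := by decide

lemma side_tab' : ∀ a q e f : Bool,
    100 * wt f e q true false ≤ 9799 + (cond q 4680 95) * tab e q true false a * 2 / 10000 := by decide

lemma z_tab : ∀ a e : Bool, 10 * (cond a 4680 95 + cond e 4680 95) ≤ 9 * 2 * tab a true false true e := by decide

lemma wt_ge (a b c d e : Bool) : 100 ≤ wt a b c d e := by revert a b c d e; decide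
lemma wt_le (a b c d e : Bool) : wt a b c d e ≤ 285 := by revert a b c d e; decide
lemma tab_pos (a b c d e : Bool) : 0 < tab a b c d e := by revert a b c d e; decide

lemma slope {m : ℝ} (hm : 0 < m) (t t' : ℝ) : ∃ σ : ℝ, 0 ≤ σ ∧ σ * (2 * m) ≤ 1 ∧
    √(max t (m ^ 2)) - √(max t' (m ^ 2)) = σ * (t - t') := by
  have key : ∀ t t' : ℝ, t' < t → ∃ σ : ℝ, 0 ≤ σ ∧ σ * (2 * m) ≤ 1 ∧
    √(max t (m ^ 2)) - √(max t' (m ^ 2)) = σ * (t - t') := by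
    intro t t' h
    have hd : 0 < t - t' := by linarith
    have h1 : m ≤ √(max t (m ^ 2)) := Real.le_sqrt_of_sq_le (le_max_right _ _)
    have h2 : m ≤ √(max t' (m ^ 2)) := Real.le_sqrt_of_sq_le (le_max_right _ _)
    have h3 : √(max t' (m ^ 2)) ≤ √(max t (m ^ 2)) := Real.sqrt_le_sqrt (max_le_max_right _ h.le)
    have q1 : √(max t (m ^ 2)) ^ 2 = max t (m ^ 2) := Real.sq_sqrt (le_max_of_le_right (sq_nonneg m))
    have q2 : √(max t' (m ^ 2)) ^ 2 = max t' (m ^ 2) := Real.sq_sqrt (le_max_of_le_right (sq_nonneg m))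
    have h4 : max t (m ^ 2) - max t' (m ^ 2) ≤ t - t' := by
      rcases max_cases t (m ^ 2) with ⟨e, _⟩ | ⟨e, _⟩ <;> rcases max_cases t' (m ^ 2) with ⟨e', _⟩ | ⟨e', _⟩ <;>
        rw [e, e'] <;> linarith
    set f := √(max t (m ^ 2))
    set g := √(max t' (m ^ 2))
    refine ⟨(f - g) / (t - t'), div_nonneg (by linarith) hd.le, ?_, by field_simp⟩
    rw [div_mul_eq_mul_div, div_le_one hd]
    nlinarith
  rcases lt_trichotomy t t' with h | h | h
  · obtain ⟨σ, a, b, c⟩ := key t' t h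
    exact ⟨σ, a, b, by linarith⟩
  · exact ⟨0, le_rfl, by linarith, by rw [h]; ring⟩
  · exact key t t' h

lemma mr_pos (s : ℤ → Bool) (n : ℤ) : 0 < mr s n := by
  have : 0 < mw s n := tab_pos _ _ _ _ _
  unfold mr; positivity

lemma mr_le (s : ℤ → Bool) (n : ℤ) : mr s n ≤ 2 := by
  have : (mw s n : ℝ) ≤ 20000 := by exact_mod_cast tab_le _ _ _ _ _
  unfold mr; linarith

lemma wr_ge (s : ℤ → Bool) (n : ℤ) : 1 ≤ wr s n := by
  have : (100 : ℝ) ≤ ww s n := by exact_mod_cast wt_ge _ _ _ _ _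
  unfold wr; linarith

lemma wr_le (s : ℤ → Bool) (n : ℤ) : wr s n ≤ 3 := by
  have : (ww s n : ℝ) ≤ 285 := by exact_mod_cast wt_le _ _ _ _ _
  unfold wr; linarith

noncomputable def ff (s : ℤ → Bool) (n : ℤ) (t : ℝ) : ℝ := √(max t (mr s n ^ 2))

noncomputable def FF (a b : ℝ) (s : ℤ → Bool) (n : ℤ) (u v : ℝ) : ℝ :=
  cond (s n) (ff s n (a - u - b * v)) (- ff s n (a - u - b * v))

def Rel (a b : ℝ) (s : ℤ → Bool) (x y : ℤ → ℝ) : Prop := ∀ n,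
  (isZ s n = false → y n = FF a b s n (x (n + 1)) (x (n - 1))) ∧
  (isZ s n = true → y n = - ff s n (a - ff s (n + 1) (a - x (n + 2) - b * y n)
    - b * ff s (n - 1) (a - y n - b * x (n - 2))))

lemma nonZ_ineq {s : ℤ → Bool} {n : ℤ} (h : isZ s n = false) :
    1000 * (wr s (n + 1) + wr s (n - 1)) ≤ 979 * wr s n * (2 * mr s n) := by
  have := wt_tab (s (n - 3)) (s (n - 2)) (s (n - 1)) (s n) (s (n + 1)) (s (n + 2)) (s (n + 3)) h
  have h2 : 1000 * 100 * 100 * (ww s (n + 1) + ww s (n - 1)) ≤ 979 * ww s n * (2 * mw s n) := by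
    convert this using 3
    · unfold ww; congr 1 <;> congr 1 <;> ring_nf
    · unfold ww; congr 1 <;> congr 1 <;> ring_nf
    · rfl
    · rfl
  have h3 : (1000 * 100 * 100 * (ww s (n + 1) + ww s (n - 1)) : ℝ) ≤ 979 * ww s n * (2 * mw s n) := by
    exact_mod_cast h2
  unfold wr mr
  linarith

/-- side constant -/
noncomputable def Q (q : Bool) : ℝ := (cond q 4680 95 : ℕ) / 10000

lemma side_ineq {s : ℤ → Bool} {n : ℤ} (h : isZ s n = true) :
    wr s (n + 2) ≤ 0.9799 + Q (s (n + 2)) * (2 * mr s (n + 1)) ∧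
    wr s (n - 2) ≤ 0.9799 + Q (s (n - 2)) * (2 * mr s (n - 1)) ∧
    Q (s (n - 2)) + Q (s (n + 2)) ≤ 0.9 * (2 * mr s n) := by
  simp only [isZ, Bool.and_eq_true, Bool.not_eq_true'] at h
  obtain ⟨⟨h0, h1⟩, h2⟩ := h
  have aux : ∀ w q m : ℕ, 100 * w ≤ 9799 + q * m * 2 / 10000 →
      (w : ℝ) / 100 ≤ 0.9799 + (q : ℝ) / 10000 * (2 * ((m : ℝ) / 10000)) := by
    intro w q m h
    have h' : 10000 * (100 * w) ≤ 10000 * 9799 + q * m * 2 := by omega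
    have h3 : (10000 * (100 * w) : ℝ) ≤ 10000 * 9799 + q * m * 2 := by exact_mod_cast h'
    linarith
  refine ⟨?_, ?_, ?_⟩
  · have := side_tab (s (n - 1)) (s (n + 2)) (s (n + 3)) (s (n + 4))
    refine aux _ _ _ ?_
    convert this using 3
    · unfold ww; rw [← h0, ← h2]; congr 1 <;> congr 1 <;> ring_nf
    · unfold mw; rw [← h0, ← h2]; congr 3 <;> congr 1 <;> ring_nf
  · have := side_tab' (s (n + 1)) (s (n - 2)) (s (n - 3)) (s (n - 4))
    refine aux _ _ _ ?_
    convert this using 3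
    · unfold ww; rw [← h0, ← h1]; congr 1 <;> congr 1 <;> ring_nf
    · unfold mw; rw [← h0, ← h1]; congr 3 <;> congr 1 <;> ring_nf
  · have := z_tab (s (n - 2)) (s (n + 2))
    have h3 : mw s n = tab (s (n - 2)) true false true (s (n + 2)) := by
      unfold mw; rw [h0, h1, h2]
    rw [← h3] at this
    have h4 : (10 * ((cond (s (n - 2)) 4680 95 : ℕ) + (cond (s (n + 2)) 4680 95 : ℕ)) : ℝ) ≤ 9 * 2 * mw s n := by
      exact_mod_cast this
    unfold Q mr
    linarith

end HP

namespace HP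

lemma ff_slope (s : ℤ → Bool) (n : ℤ) (t t' : ℝ) : ∃ σ : ℝ, 0 ≤ σ ∧ σ * (2 * mr s n) ≤ 1 ∧
    ff s n t - ff s n t' = σ * (t - t') := slope (mr_pos s n) t t'

lemma ff_cont (s : ℤ → Bool) (n : ℤ) : Continuous (ff s n) := by unfold ff; fun_prop

lemma ff_nonneg (s : ℤ → Bool) (n : ℤ) (t : ℝ) : 0 ≤ ff s n t := Real.sqrt_nonneg _

lemma ff_ge (s : ℤ → Bool) (n : ℤ) (t : ℝ) : mr s n ≤ ff s n t := Real.le_sqrt_of_sq_le (le_max_right _ _)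

lemma ff_sq (s : ℤ → Bool) (n : ℤ) (t : ℝ) : ff s n t ^ 2 = max t (mr s n ^ 2) :=
  Real.sq_sqrt (le_max_of_le_right (sq_nonneg _))

lemma ff_le {s : ℤ → Bool} {n : ℤ} {t : ℝ} (h : t ≤ 9) : ff s n t ≤ 3 := by
  refine Real.sqrt_le_iff.2 ⟨by norm_num, max_le (by linarith) ?_⟩
  have := mr_le s n; have := mr_pos s n; nlinarith

section
variable {a b : ℝ} {s : ℤ → Bool}

lemma b_facts (h : Par a b) : b ^ 2 ≤ 1.00001 * b ∧ b ^ 2 ≤ 1.00001 ∧ 0.99999 ≤ b := by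
  obtain ⟨-, -, hb1, hb2⟩ := h
  have h1 : b ^ 2 ≤ 1.000001 * b := by
    rw [pow_two]; exact mul_le_mul_of_nonneg_right (by linarith) (by linarith)
  refine ⟨by linarith, by linarith, by linarith⟩

set_option maxHeartbeats 1000000 in
lemma contraction (h : Par a b) {x x' y y' : ℤ → ℝ} (hy : Rel a b s x y) (hy' : Rel a b s x' y') {C : ℝ} (hC : 0 ≤ C)
    (hd : ∀ n, |x n - x' n| ≤ C * wr s n) (n : ℤ) : |y n - y' n| ≤ 0.98 * C * wr s n := by
  obtain ⟨b2, b3, b4⟩ := b_facts h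
  obtain ⟨-, -, hb1, hb2⟩ := h
  have w1 := wr_ge s n
  rcases hz : isZ s n with _ | _
  · have e1 := (hy n).1 hz
    have e2 := (hy' n).1 hz
    obtain ⟨σ, s0, s1, es⟩ := ff_slope s n (a - x (n + 1) - b * x (n - 1)) (a - x' (n + 1) - b * x' (n - 1))
    have e3 : |y n - y' n| = σ * |(x (n + 1) - x' (n + 1)) + b * (x (n - 1) - x' (n - 1))| := by
      have : σ * |(x (n + 1) - x' (n + 1)) + b * (x (n - 1) - x' (n - 1))| =
          |ff s n (a - x (n + 1) - b * x (n - 1)) - ff s n (a - x' (n + 1) - b * x' (n - 1))| := by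
        rw [es, abs_mul, abs_of_nonneg s0, ← abs_neg]; congr 2; ring
      rw [this, e1, e2]
      unfold FF
      cases s n
      · simp only [cond]; rw [← abs_neg]; congr 1; ring
      · simp only [cond]
    have e4 : |(x (n + 1) - x' (n + 1)) + b * (x (n - 1) - x' (n - 1))| ≤ C * wr s (n + 1) + b * (C * wr s (n - 1)) := by
      refine (abs_add_le _ _).trans (add_le_add (hd _) ?_)
      rw [abs_mul, abs_of_nonneg (by linarith)]
      exact mul_le_mul_of_nonneg_left (hd _) (by linarith)
    have e5 := nonZ_ineq hz
    have hm := mr_pos s n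
    have v1 := wr_ge s (n - 1)
    have v2 := wr_ge s (n + 1)
    have e6 : wr s (n + 1) + b * wr s (n - 1) ≤ 0.98 * wr s n * (2 * mr s n) := by
      have : b * wr s (n - 1) ≤ (1 + 1 / 1000000) * wr s (n - 1) :=
        mul_le_mul_of_nonneg_right hb2.le (by linarith)
      linarith
    rw [e3]
    calc σ * |(x (n + 1) - x' (n + 1)) + b * (x (n - 1) - x' (n - 1))|
        ≤ σ * (C * (wr s (n + 1) + b * wr s (n - 1))) := mul_le_mul_of_nonneg_left (by linarith) s0
      _ ≤ σ * (C * (0.98 * wr s n * (2 * mr s n))) :=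
          mul_le_mul_of_nonneg_left (mul_le_mul_of_nonneg_left e6 hC) s0
      _ = (0.98 * C * wr s n) * (σ * (2 * mr s n)) := by ring
      _ ≤ (0.98 * C * wr s n) * 1 := mul_le_mul_of_nonneg_left s1 (by positivity)
      _ = _ := mul_one _
  · have e1 := (hy n).2 hz
    have e2 := (hy' n).2 hz
    obtain ⟨p, p0, p1, ep⟩ := ff_slope s (n + 1) (a - x (n + 2) - b * y n) (a - x' (n + 2) - b * y' n)
    obtain ⟨q, q0, q1, eq⟩ := ff_slope s (n - 1) (a - y n - b * x (n - 2)) (a - y' n - b * x' (n - 2))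
    obtain ⟨σ, s0, s1, es⟩ := ff_slope s n
      (a - ff s (n + 1) (a - x (n + 2) - b * y n) - b * ff s (n - 1) (a - y n - b * x (n - 2)))
      (a - ff s (n + 1) (a - x' (n + 2) - b * y' n) - b * ff s (n - 1) (a - y' n - b * x' (n - 2)))
    obtain ⟨f1, f2, f3⟩ := side_ineq hz
    have hu := hd (n + 2)
    have hv := hd (n - 2)
    set du := x (n + 2) - x' (n + 2) with hdu
    set dv := x (n - 2) - x' (n - 2) with hdv
    set d := y n - y' n with hdd
    have ep' : ff s (n + 1) (a - x (n + 2) - b * y n) - ff s (n + 1) (a - x' (n + 2) - b * y' n)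
        = p * (-du - b * d) := by rw [ep, hdu, hdd]; ring
    have eq' : ff s (n - 1) (a - y n - b * x (n - 2)) - ff s (n - 1) (a - y' n - b * x' (n - 2))
        = q * (-d - b * dv) := by rw [eq, hdv, hdd]; ring
    have ed : d = σ * (p * (-du - b * d) + b * (q * (-d - b * dv))) := by
      rw [← ep', ← eq']
      have : d = -(σ * ((a - ff s (n + 1) (a - x (n + 2) - b * y n) - b * ff s (n - 1) (a - y n - b * x (n - 2))) -
        (a - ff s (n + 1) (a - x' (n + 2) - b * y' n) - b * ff s (n - 1) (a - y' n - b * x' (n - 2))))) := by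
        rw [← es, hdd]; linarith
      rw [this]; ring
    have ed2 : d * (1 + σ * b * (p + q)) = -(σ * (p * du + b ^ 2 * (q * dv))) := by linarith
    have hpos : 0 ≤ σ * b * (p + q) := mul_nonneg (mul_nonneg s0 (by linarith)) (by linarith)
    have ed3 : |d| * (1 + σ * b * (p + q)) ≤ σ * (p * (C * wr s (n + 2)) + b ^ 2 * (q * (C * wr s (n - 2)))) := by
      have : |d| * (1 + σ * b * (p + q)) = |σ * (p * du + b ^ 2 * (q * dv))| := by
        rw [← abs_neg (σ * _), ← ed2, abs_mul, abs_of_nonneg (by linarith : 0 ≤ 1 + σ * b * (p + q))]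
      rw [this, abs_mul, abs_of_nonneg s0]
      refine mul_le_mul_of_nonneg_left ((abs_add_le _ _).trans (add_le_add ?_ ?_)) s0
      · rw [abs_mul, abs_of_nonneg p0]; exact mul_le_mul_of_nonneg_left hu p0
      · rw [abs_mul, abs_mul, abs_of_nonneg q0, abs_of_nonneg (sq_nonneg b)]
        exact mul_le_mul_of_nonneg_left (mul_le_mul_of_nonneg_left hv q0) (sq_nonneg b)
    have hQ : ∀ q, 0 ≤ Q q := fun q => by unfold Q; positivity
    -- p * wr ≤ 0.98 b p + Q
    have g1 : p * wr s (n + 2) ≤ 0.9799 * p + Q (s (n + 2)) := by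
      have h1 := mul_le_mul_of_nonneg_left f1 p0
      have h2 := mul_le_mul_of_nonneg_left p1 (hQ (s (n + 2)))
      linarith
    have g2 : q * wr s (n - 2) ≤ 0.9799 * q + Q (s (n - 2)) := by
      have h1 := mul_le_mul_of_nonneg_left f2 q0
      have h2 := mul_le_mul_of_nonneg_left q1 (hQ (s (n - 2)))
      linarith
    have g3 : p * wr s (n + 2) + b ^ 2 * (q * wr s (n - 2)) ≤
        0.98 * b * (p + q) + 1.00001 * (Q (s (n - 2)) + Q (s (n + 2))) := by
      have h1 := mul_le_mul_of_nonneg_left g2 (sq_nonneg b)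
      have h2 := mul_le_mul_of_nonneg_right b2 q0
      have h3 := mul_le_mul_of_nonneg_right b3 (hQ (s (n - 2)))
      have h4 := mul_le_mul_of_nonneg_right b4 p0
      have h5 := hQ (s (n + 2))
      have h6 := mul_nonneg (by linarith : 0 ≤ b) q0
      linarith
    have g4 : σ * (p * wr s (n + 2) + b ^ 2 * (q * wr s (n - 2))) ≤ 0.98 * (1 + σ * b * (p + q)) := by
      have h1 := mul_le_mul_of_nonneg_left g3 s0
      have h2 := mul_le_mul_of_nonneg_left f3 s0
      linarith
    have g5 : |d| * (1 + σ * b * (p + q)) ≤ (0.98 * C) * (1 + σ * b * (p + q)) := by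
      have := mul_le_mul_of_nonneg_left g4 hC
      linarith
    have g6 := le_of_mul_le_mul_right g5 (by linarith)
    exact g6.trans (le_mul_of_one_le_right (by positivity) w1)

lemma rel_exists (h : Par a b) (x : ℤ → ℝ) : ∃ y, Rel a b s x y := by
  have : ∀ n, ∃ z : ℝ, (isZ s n = false → z = FF a b s n (x (n + 1)) (x (n - 1))) ∧
    (isZ s n = true → z = - ff s n (a - ff s (n + 1) (a - x (n + 2) - b * z)
    - b * ff s (n - 1) (a - z - b * x (n - 2)))) := by
    intro n
    rcases hz : isZ s n with _ | _
    · exact ⟨_, fun _ => rfl, by simp⟩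
    · obtain ⟨h1, h2, hb1, hb2⟩ := h
      let g : ℝ → ℝ := fun z => z + ff s n (a - ff s (n + 1) (a - x (n + 2) - b * z)
        - b * ff s (n - 1) (a - z - b * x (n - 2)))
      have hg : Continuous g := by
        have c1 := ff_cont s n
        have c2 := ff_cont s (n + 1)
        have c3 := ff_cont s (n - 1)
        fun_prop
      have g1 : g (-3) ≤ 0 := by
        have : ff s n (a - ff s (n + 1) (a - x (n + 2) - b * (-3))
          - b * ff s (n - 1) (a - (-3) - b * x (n - 2))) ≤ 3 := by
          apply ff_le
          have h5 := ff_nonneg s (n + 1) (a - x (n + 2) - b * (-3))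
          have h6 := mul_nonneg (by linarith : 0 ≤ b) (ff_nonneg s (n - 1) (a - (-3) - b * x (n - 2)))
          linarith
        simp only [g]; linarith
      have g2 : 0 ≤ g 0 := by
        simp only [g]; linarith [ff_nonneg s n (a - ff s (n + 1) (a - x (n + 2) - b * 0)
          - b * ff s (n - 1) (a - 0 - b * x (n - 2)))]
      obtain ⟨z, -, hz⟩ := intermediate_value_Icc (by norm_num : (-3 : ℝ) ≤ 0) hg.continuousOn ⟨g1, g2⟩
      refine ⟨z, by simp, fun _ => ?_⟩
      simp only [g] at hz
      linarith
  choose y hy using this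
  exact ⟨y, hy⟩

lemma rel_bdd (h : Par a b) {y : ℤ → ℝ} (hy : Rel a b s (fun _ => 0) y) (n : ℤ) : |y n| ≤ 3 := by
  obtain ⟨h1, h2, hb1, hb2⟩ := h
  rcases hz : isZ s n with _ | _
  · rw [(hy n).1 hz]
    have : ff s n (a - 0 - b * 0) ≤ 3 := ff_le (by linarith)
    have h0 := ff_nonneg s n (a - 0 - b * 0)
    unfold FF
    cases s n
    · simp only [cond]; rw [abs_neg, abs_of_nonneg h0]; exact this
    · simp only [cond]; rw [abs_of_nonneg h0]; exact this
  · rw [(hy n).2 hz, abs_neg, abs_of_nonneg (ff_nonneg _ _ _)]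
    apply ff_le
    have h5 := ff_nonneg s (n + 1) (a - 0 - b * y n)
    have h6 := mul_nonneg (by linarith : 0 ≤ b) (ff_nonneg s (n - 1) (a - y n - b * 0))
    linarith

lemma rel_unique (h : Par a b) {x x' : ℤ → ℝ} (hx : Rel a b s x x) (hx' : Rel a b s x' x') {K : ℝ}
    (hK : ∀ n, |x n - x' n| ≤ K) : x = x' := by
  have hK0 : 0 ≤ K := (abs_nonneg _).trans (hK 0)
  have key : ∀ k : ℕ, ∀ n, |x n - x' n| ≤ (0.98 ^ k * K) * wr s n := by
    intro k
    induction k with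
    | zero => intro n; rw [pow_zero, one_mul]; exact (hK n).trans (le_mul_of_one_le_right hK0 (wr_ge s n))
    | succ k ih =>
      intro n
      have := contraction h hx hx' (by positivity) ih n
      rw [pow_succ]
      linarith
  funext n
  have ht : Filter.Tendsto (fun k : ℕ => ((0.98 : ℝ) ^ k * K) * wr s n) Filter.atTop (nhds 0) := by
    have := ((tendsto_pow_atTop_nhds_zero_of_lt_one (by norm_num : (0 : ℝ) ≤ 0.98) (by norm_num)).mul_const K).mul_const (wr s n)
    simpa using this
  have := ge_of_tendsto' ht (fun k => key k n)
  have := abs_nonpos_iff.1 this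
  linarith

lemma rel_fix (h : Par a b) (s : ℤ → Bool) : ∃ x, Rel a b s x x ∧ ∃ K, ∀ n, |x n| ≤ K := by
  choose T hT using fun x => rel_exists (s := s) h x
  let X : ℕ → ℤ → ℝ := fun k => T^[k] (fun _ => 0)
  have hX : ∀ k, X (k + 1) = T (X k) := fun k => Function.iterate_succ_apply' T k _
  have hRel : ∀ k, Rel a b s (X k) (X (k + 1)) := fun k => by rw [hX]; exact hT _
  have key : ∀ k n, |X k n - X (k + 1) n| ≤ (0.98 ^ k * 3) * wr s n := by
    intro k
    induction k with
    | zero =>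
      intro n
      have := rel_bdd h (hRel 0) n
      have h1 := wr_ge s n
      have : |X 0 n - X (0 + 1) n| ≤ 3 := by
        rw [show X 0 n = 0 from rfl, zero_sub, abs_neg]; exact this
      rw [pow_zero]; linarith
    | succ k ih =>
      intro n
      have := contraction h (hRel k) (hRel (k + 1)) (by positivity) ih n
      rw [pow_succ]
      linarith
  have key2 : ∀ n k, dist (X k n) (X (k + 1) n) ≤ (3 * wr s n) * 0.98 ^ k := by
    intro n k; rw [Real.dist_eq]; have := key k n; linarith
  have hC : ∀ n, ∃ l, Filter.Tendsto (fun k => X k n) Filter.atTop (nhds l) := fun n =>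
    cauchySeq_tendsto_of_complete (cauchySeq_of_le_geometric _ _ (by norm_num) (key2 n))
  choose L hL using hC
  have hdist : ∀ k n, |X k n - L n| ≤ (150 * 0.98 ^ k) * wr s n := by
    intro k n
    have := dist_le_of_le_geometric_of_tendsto 0.98 _ (by norm_num) (key2 n) (hL n) k
    rw [Real.dist_eq] at this
    refine this.trans (le_of_eq ?_)
    rw [show (1 - 0.98 : ℝ) = 1 / 50 by norm_num]; ring
  have hTL : T L = L := by
    funext n
    have h1 : ∀ k, |X (k + 1) n - T L n| ≤ 0.98 * (150 * 0.98 ^ k) * wr s n := fun k =>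
      contraction h (hRel k) (hT L) (by positivity) (hdist k) n
    have ht : Filter.Tendsto (fun k : ℕ => 0.98 * (150 * (0.98 : ℝ) ^ k) * wr s n) Filter.atTop (nhds 0) := by
      have := (((tendsto_pow_atTop_nhds_zero_of_lt_one (by norm_num : (0 : ℝ) ≤ 0.98) (by norm_num)).const_mul 150).const_mul 0.98).mul_const (wr s n)
      simpa using this
    have h2 : Filter.Tendsto (fun k => X (k + 1) n - T L n) Filter.atTop (nhds 0) :=
      squeeze_zero_norm h1 ht
    have h3 : Filter.Tendsto (fun k => X (k + 1) n - T L n) Filter.atTop (nhds (L n - T L n)) :=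
      ((hL n).comp (Filter.tendsto_add_atTop_nat 1)).sub_const _
    have := tendsto_nhds_unique h2 h3
    linarith
  refine ⟨L, ?_, 450, fun n => ?_⟩
  · have := hT L; rwa [hTL] at this
  · have h1 := hdist 0 n
    have h2 := wr_le s n
    rw [show X 0 n = 0 from rfl, zero_sub, abs_neg] at h1
    norm_num at h1
    linarith

/-- clamped orbits -/
def Cl (a b : ℝ) (s : ℤ → Bool) (x : ℤ → ℝ) : Prop := ∀ n, x n = FF a b s n (x (n + 1)) (x (n - 1))

lemma cl_iff {x : ℤ → ℝ} : Cl a b s x ↔ Rel a b s x x := by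
  constructor
  · intro h n
    refine ⟨fun _ => h n, fun hz => ?_⟩
    simp only [isZ, Bool.and_eq_true, Bool.not_eq_true'] at hz
    obtain ⟨⟨h0, h1⟩, h2⟩ := hz
    have e0 := h n
    have e1 := h (n + 1)
    have e2 := h (n - 1)
    simp only [FF, h0, h1, h2, cond] at e0 e1 e2
    rw [show n + 1 + 1 = n + 2 by ring, show n + 1 - 1 = n by ring] at e1
    rw [show n - 1 - 1 = n - 2 by ring, show n - 1 + 1 = n by ring] at e2
    rw [← e1, ← e2, ← e0]
  · intro h n
    rcases hz : isZ s n with _ | _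
    · exact (h n).1 hz
    · have e0 := (h n).2 hz
      simp only [isZ, Bool.and_eq_true, Bool.not_eq_true'] at hz
      obtain ⟨⟨h0, h1⟩, h2⟩ := hz
      have e1 := (h (n + 1)).1 (by simp [isZ, h2])
      have e2 := (h (n - 1)).1 (by simp [isZ, h1])
      simp only [FF, h0, h1, h2, cond] at e1 e2 ⊢
      rw [show n + 1 + 1 = n + 2 by ring, show n + 1 - 1 = n by ring] at e1
      rw [show n - 1 - 1 = n - 2 by ring, show n - 1 + 1 = n by ring] at e2
      rw [← e1, ← e2] at e0
      exact e0

lemma bound (h : Par a b) {x : ℤ → ℝ} {K : ℝ} (hK : ∀ n, |x n| ≤ K)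
    (hx : ∀ n, x n ^ 2 ≤ max (a - x (n + 1) - b * x (n - 1)) 4) (n : ℤ) : |x n| ≤ 3.544 := by
  obtain ⟨h1, h2, hb1, hb2⟩ := h
  have hbd : BddAbove (Set.range fun n => |x n|) := ⟨K, by rintro _ ⟨n, rfl⟩; exact hK n⟩
  set M := ⨆ n, |x n| with hM
  have hle : ∀ n, |x n| ≤ M := fun n => le_ciSup hbd n
  have hM0 : 0 ≤ M := (abs_nonneg _).trans (hle 0)
  have key : ∀ n, |x n| ≤ √(max (a + (1 + b) * M) 4) := by
    intro n
    apply Real.le_sqrt_of_sq_le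
    rw [sq_abs]
    refine (hx n).trans (max_le_max_right _ ?_)
    have e1 := abs_le.1 (hle (n + 1))
    have e2 := abs_le.1 (hle (n - 1))
    have := mul_le_mul_of_nonneg_left e2.1 (by linarith : 0 ≤ b)
    linarith
  have hMle : M ≤ √(max (a + (1 + b) * M) 4) := ciSup_le key
  have hM2 : M ^ 2 ≤ max (a + (1 + b) * M) 4 := by
    have := pow_le_pow_left₀ hM0 hMle 2
    rwa [Real.sq_sqrt (le_max_of_le_right (by norm_num))] at this
  refine (hle n).trans ?_
  by_contra hc
  rw [not_le] at hc
  rcases le_max_iff.1 hM2 with e | e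
  · have : (1 + b) * M ≤ 2.000001 * M := mul_le_mul_of_nonneg_right (by linarith) hM0
    nlinarith
  · nlinarith

lemma cl_props (h : Par a b) {x : ℤ → ℝ} (hx : Cl a b s x) :
    (∀ n, x n ^ 2 = max (a - x (n + 1) - b * x (n - 1)) (mr s n ^ 2)) ∧
    (∀ n, s n = true → mr s n ≤ x n) ∧ (∀ n, s n = false → x n ≤ - mr s n) := by
  refine ⟨fun n => ?_, fun n hn => ?_, fun n hn => ?_⟩
  · rw [← ff_sq]
    conv_lhs => rw [hx n]
    unfold FF
    cases s n <;> simp only [cond] <;> ring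
  · rw [hx n]; simp only [FF, hn, cond]; exact ff_ge _ _ _
  · rw [hx n]; simp only [FF, hn, cond]; linarith [ff_ge s n (a - x (n + 1) - b * x (n - 1))]

/-- realization of admissible codes -/
theorem realize (h : Par a b) (hs : Adm s) : ∃ x : ℤ → ℝ, (∃ K, ∀ n, |x n| ≤ K) ∧
    (∀ n, x (n + 1) + b * x (n - 1) = a - x n ^ 2) ∧ (∀ n, s n = true → 0 < x n) ∧ (∀ n, s n = false → x n < 0) := by
  obtain ⟨x, hx, K, hK⟩ := rel_fix h s
  have hc := cl_iff.2 hx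
  obtain ⟨h1, h2, h3⟩ := cl_props h hc
  refine ⟨x, ⟨K, hK⟩, engC h (bound h hK fun n => ?_) hs h1 h2 h3, fun n hn => ?_, fun n hn => ?_⟩
  · rw [h1]
    have := mr_le s n; have := mr_pos s n
    exact max_le_max_left _ (by nlinarith)
  · linarith [h2 n hn, mr_pos s n]
  · linarith [h3 n hn, mr_pos s n]

/-- an orbit is determined by its code -/
theorem orbit_code (h : Par a b) {x : ℤ → ℝ} (hK : ∃ K, ∀ n, |x n| ≤ K)
    (ho : ∀ n, x (n + 1) + b * x (n - 1) = a - x n ^ 2)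
    (hs1 : ∀ n, s n = true → 0 ≤ x n) (hs0 : ∀ n, s n = false → x n ≤ 0) :
    Adm s ∧ (∀ n, x n ≠ 0) ∧ Cl a b s x := by
  obtain ⟨K, hK⟩ := hK
  have hb := bound h hK fun n => (by linarith [ho n] : x n ^ 2 ≤ a - x (n + 1) - b * x (n - 1)).trans (le_max_left _ _)
  obtain ⟨ha, hm⟩ := engA h hb ho hs1 hs0
  refine ⟨ha, fun n h0 => ?_, fun n => ?_⟩
  · have := mr_pos s n
    rcases hn : s n with _ | _
    · linarith [(hm n).2 hn]
    · linarith [(hm n).1 hn]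
  · have hp := mr_pos s n
    have e : a - x (n + 1) - b * x (n - 1) = x n ^ 2 := by linarith [ho n]
    simp only [FF, ff, e]
    rcases hn : s n with _ | _
    · have := (hm n).2 hn
      rw [max_eq_left (by nlinarith), Real.sqrt_sq_eq_abs, abs_of_nonpos (by linarith)]; simp
    · have := (hm n).1 hn
      rw [max_eq_left (by nlinarith), Real.sqrt_sq_eq_abs, abs_of_nonneg (by linarith)]; simp

theorem orbit_unique (h : Par a b) {x x' : ℤ → ℝ} (hK : ∃ K, ∀ n, |x n| ≤ K) (hK' : ∃ K, ∀ n, |x' n| ≤ K)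
    (hx : Cl a b s x) (hx' : Cl a b s x') : x = x' := by
  obtain ⟨K, hK⟩ := hK
  obtain ⟨K', hK'⟩ := hK'
  exact rel_unique h (cl_iff.1 hx) (cl_iff.1 hx') (K := K + K')
    (fun n => (abs_sub _ _).trans (add_le_add (hK n) (hK' n)))

end
end HP

namespace HP

noncomputable def He (a b : ℝ) (hb : b ≠ 0) : (ℝ × ℝ) ≃ₜ (ℝ × ℝ) where
  toFun := henon a b
  invFun p := (p.2, (a - p.2 ^ 2 - p.1) / b)
  left_inv p := by
    ext
    · rfl
    · simp only [henon]; field_simp; ring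
  right_inv p := by
    ext
    · simp only [henon]; field_simp; ring
    · rfl
  continuous_toFun := by unfold henon; fun_prop
  continuous_invFun := by fun_prop

section
variable {a b : ℝ} (hb : b ≠ 0)

noncomputable def X (a : ℝ) {b : ℝ} (hb : b ≠ 0) (n : ℤ) (p : ℝ × ℝ) : ℝ := ((He a b hb ^ n) p).1

lemma He_succ (n : ℤ) (p : ℝ × ℝ) : (He a b hb ^ (n + 1)) p = henon a b ((He a b hb ^ n) p) := by
  rw [add_comm, zpow_one_add]; rfl

lemma He_succ2 (n : ℤ) (p : ℝ × ℝ) : (He a b hb ^ n) (henon a b p) = (He a b hb ^ (n + 1)) p := by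
  rw [zpow_add_one]; rfl

lemma He_snd (n : ℤ) (p : ℝ × ℝ) : ((He a b hb ^ n) p).2 = X a hb (n - 1) p := by
  have := He_succ (a := a) hb (n - 1) p
  rw [sub_add_cancel] at this
  rw [this]; rfl

lemma X_rec (n : ℤ) (p : ℝ × ℝ) : X a hb (n + 1) p + b * X a hb (n - 1) p = a - X a hb n p ^ 2 := by
  rw [← He_snd, X, He_succ]
  simp only [henon, X]; ring

lemma X_cont (n : ℤ) : Continuous (X a hb n) :=
  continuous_fst.comp (He a b hb ^ n).continuous

lemma X_henon (n : ℤ) (p : ℝ × ℝ) : X a hb n (henon a b p) = X a hb (n + 1) p := by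
  rw [X, He_succ2]; rfl

lemma p_eq (p : ℝ × ℝ) : p = (X a hb 0 p, X a hb (-1) p) := by
  have h1 : X a hb 0 p = p.1 := by rw [X, zpow_zero]; rfl
  have h2 := He_snd (a := a) hb 0 p
  rw [zpow_zero, zero_sub] at h2
  rw [h1, ← h2]; rfl

lemma orb_eq {o : ℤ → ℝ × ℝ} (ho : ∀ n : ℤ, o (n + 1) = henon a b (o n)) (n : ℤ) :
    o n = (He a b hb ^ n) (o 0) := by
  induction n using Int.induction_on with
  | zero => rw [zpow_zero]; rfl
  | succ n ih => rw [ho, ih, He_succ]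
  | pred n ih =>
    apply (He a b hb).injective
    change henon a b _ = henon a b _
    rw [← ho, ← He_succ, sub_add_cancel, ih]

lemma memK {p : ℝ × ℝ} : p ∈ henonK a b ↔ ∃ K, ∀ n, |X a hb n p| ≤ K := by
  constructor
  · rintro ⟨o, rfl, ho, hbd⟩
    obtain ⟨K, hK⟩ := hbd.exists_norm_le
    refine ⟨K, fun n => ?_⟩
    have := hK (o n) ⟨n, rfl⟩
    rw [X, ← orb_eq hb ho]
    exact (norm_fst_le _).trans this
  · rintro ⟨K, hK⟩
    refine ⟨fun n => (He a b hb ^ n) p, by simp only [zpow_zero]; rfl, fun n => He_succ hb n p, ?_⟩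
    rw [isBounded_iff_forall_norm_le]
    refine ⟨K, ?_⟩
    rintro _ ⟨n, rfl⟩
    refine norm_prod_le_iff.2 ⟨hK n, ?_⟩
    simp only [He_snd]; exact hK _

lemma seq_eq {x : ℤ → ℝ} (hx : ∀ n, x (n + 1) + b * x (n - 1) = a - x n ^ 2) (n : ℤ) :
    X a hb n (x 0, x (-1)) = x n := by
  have := orb_eq (a := a) hb (o := fun n => (x n, x (n - 1))) (fun n => by
    simp only [henon, add_sub_cancel_right]
    ext
    · simp only []; linarith [hx n]
    · rfl) n
  simp only [zero_sub] at this
  rw [X, ← this]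

lemma memK2 (h : Par a b) {p : ℝ × ℝ} : p ∈ henonK a b ↔ ∀ n, |X a hb n p| ≤ 3.544 := by
  rw [memK hb]
  constructor
  · rintro ⟨K, hK⟩
    exact bound h (x := fun n => X a hb n p) hK
      (fun n => le_max_of_le_left (by linarith [X_rec (a := a) hb n p]))
  · exact fun h => ⟨_, h⟩

lemma K_compact (hb : b ≠ 0) (h : Par a b) : IsCompact (henonK a b) := by
  have hK : henonK a b = ⋂ n, {p | |X a hb n p| ≤ 3.544} := by
    ext p; rw [memK2 hb h]; simp
  refine (isCompact_closedBall (0 : ℝ × ℝ) 3.544).of_isClosed_subset ?_ ?_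
  · rw [hK]
    exact isClosed_iInter fun n => isClosed_le (X_cont hb n).abs continuous_const
  · intro p hp
    rw [memK2 hb h] at hp
    rw [mem_closedBall_zero_iff, p_eq (a := a) hb p]
    exact norm_prod_le_iff.2 ⟨hp 0, hp (-1)⟩

lemma fix_iff (s : Sigma2) : s ∈ fixSet 2 2 ↔ Adm (fun n => decide (s n = 1)) := by
  have e0 : ∀ t : Fin 2, decide (t = 1) = false ↔ t = 0 := by decide
  have e2 : ∀ t : Fin 2, 1 - t ≠ t := by decide
  have hp : ∀ i, pattern 2 2 s i ↔ s (i - 3) = 0 ∧ s (i - 2) = 0 ∧ s (i - 1) = 1 ∧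
      s (i + 1) = 1 ∧ s (i + 2) = 0 ∧ s (i + 3) = 0 := by
    intro i
    constructor
    · rintro ⟨h1, h2, h3, h4⟩
      have a1 := h3 1 (by norm_num) (by norm_num)
      have a2 := h3 2 (by norm_num) (by norm_num)
      have a3 := h4 1 (by norm_num) (by norm_num)
      have a4 := h4 2 (by norm_num) (by norm_num)
      refine ⟨?_, ?_, h1, h2, ?_, ?_⟩
      · rw [← a2]; congr 1; push_cast; ring
      · rw [← a1]; congr 1; push_cast; ring
      · rw [← a3]; congr 1; push_cast; ring
      · rw [← a4]; congr 1; push_cast; ring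
    · rintro ⟨h1, h2, h3, h4, h5, h6⟩
      refine ⟨h3, h4, fun k k1 k2 => ?_, fun k k1 k2 => ?_⟩
      · interval_cases k
        · rw [← h2]; congr 1; push_cast; ring
        · rw [← h1]; congr 1; push_cast; ring
      · interval_cases k
        · rw [← h5]; congr 1; push_cast; ring
        · rw [← h6]; congr 1; push_cast; ring
  have h1 : s ∈ fixSet 2 2 ↔ ∀ i, ¬ pattern 2 2 s i := by
    constructor
    · intro h i hi
      have := congrFun h i
      rw [rho, if_pos hi] at this
      exact e2 _ this
    · intro h
      funext i
      rw [rho, if_neg (h i)]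
  rw [h1]
  simp only [hp, Adm, e0, decide_eq_true_eq]
  constructor
  · intro h k hk
    apply h (k + 3)
    rw [show k + 3 - 3 = k by ring, show k + 3 - 2 = k + 1 by ring, show k + 3 - 1 = k + 2 by ring,
      show k + 3 + 1 = k + 4 by ring, show k + 3 + 2 = k + 5 by ring, show k + 3 + 3 = k + 6 by ring]
    exact hk
  · intro h k hk
    apply h (k - 3)
    rw [show k - 3 + 1 = k - 2 by ring, show k - 3 + 2 = k - 1 by ring,
      show k - 3 + 4 = k + 1 by ring, show k - 3 + 5 = k + 2 by ring, show k - 3 + 6 = k + 3 by ring]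
    exact hk

open Classical in
noncomputable def code (p : ℝ × ℝ) : Sigma2 := fun n => if 0 ≤ X a hb n p then 1 else 0

lemma code_one (p : ℝ × ℝ) (n : ℤ) : code (a := a) hb p n = 1 ↔ 0 ≤ X a hb n p := by
  unfold code; split_ifs with h <;> simp [h]

lemma code_props (h : Par a b) {p : ℝ × ℝ} (hp : p ∈ henonK a b) :
    code (a := a) hb p ∈ fixSet 2 2 ∧ (∀ n, X a hb n p ≠ 0) ∧
      Cl a b (fun n => decide (code (a := a) hb p n = 1)) (fun n => X a hb n p) := by
  rw [fix_iff]
  refine orbit_code h ((memK hb).1 hp) (fun n => X_rec hb n p) (fun n hn => ?_) (fun n hn => ?_)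
  · rw [decide_eq_true_eq, code_one] at hn; exact hn
  · rw [decide_eq_false_iff_not, code_one] at hn; exact (not_le.1 hn).le

noncomputable def hmap (h : Par a b) (p : henonK a b) : fixSet 2 2 :=
  ⟨code (a := a) hb p, (code_props hb h p.2).1⟩

lemma hmap_cont (h : Par a b) : Continuous (hmap hb h) := by
  refine Continuous.subtype_mk (continuous_pi fun n => ?_) _
  have hc : Continuous fun p : henonK a b => X a hb n p := (X_cont hb n).comp continuous_subtype_val
  refine (IsLocallyConstant.iff_eventually_eq _).2 (fun p => ?_) |>.continuous
  have hn := (code_props hb h p.2).2.1 n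
  rcases lt_or_gt_of_ne hn with h1 | h1
  · filter_upwards [hc.continuousAt.eventually_lt continuousAt_const h1] with q hq
    simp only [code, if_neg (not_le.2 h1), if_neg (not_le.2 hq)]
  · filter_upwards [continuousAt_const.eventually_lt hc.continuousAt h1] with q hq
    simp only [code, if_pos h1.le, if_pos hq.le]

lemma hmap_bij (h : Par a b) : Function.Bijective (hmap hb h) := by
  constructor
  · intro p q hpq
    have e : code (a := a) hb p = code (a := a) hb q := congrArg Subtype.val hpq
    have c1 := (code_props hb h p.2).2.2
    have c2 := (code_props hb h q.2).2.2
    rw [e] at c1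
    have := orbit_unique h ((memK hb).1 p.2) ((memK hb).1 q.2) c1 c2
    apply Subtype.ext
    rw [p_eq (a := a) hb p, p_eq (a := a) hb q]
    have e0 := congrFun this 0
    have e1 := congrFun this (-1)
    rw [e0, e1]
  · rintro ⟨s, hs⟩
    obtain ⟨x, hK, ho, h1, h0⟩ := realize h ((fix_iff s).1 hs)
    have hx := seq_eq (a := a) hb ho
    refine ⟨⟨(x 0, x (-1)), (memK hb).2 ?_⟩, ?_⟩
    · simpa only [hx] using hK
    · apply Subtype.ext
      funext n
      change code (a := a) hb (x 0, x (-1)) n = s n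
      unfold code
      rw [hx]
      by_cases hn : s n = 1
      · rw [if_pos (h1 n (by simpa using hn)).le, hn]
      · rw [if_neg (not_le.2 (h0 n (by simpa using hn)))]
        have e0 : ∀ t : Fin 2, t ≠ 1 → 0 = t := by decide
        exact e0 _ hn

end

end HP


/-- (Main theorem, first component) There is an open connected set `A₁ ⊆ ℝ²`
containing the segment `[5.3125, 5.46875] × {1}` such that for all `(a,b) ∈ A₁`,
the Hénon map `H_{a,b}` restricted to `K^ℝ_{a,b}` is topologically conjugate to
the shift restricted to `Fix(ρ_{2,2})`. -/
theorem henon_pruning_component_one :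
    ∃ A₁ : Set (ℝ × ℝ), IsOpen A₁ ∧ IsConnected A₁ ∧
      (Set.Icc (5.3125 : ℝ) 5.46875) ×ˢ ({1} : Set ℝ) ⊆ A₁ ∧
      ∀ a b : ℝ, (a, b) ∈ A₁ →
        Set.MapsTo (henon a b) (henonK a b) (henonK a b) ∧
        ∃ h : (henonK a b) ≃ₜ (fixSet 2 2),
          ∀ (p : henonK a b) (hq : henon a b (p : ℝ × ℝ) ∈ henonK a b),
            (h ⟨henon a b (p : ℝ × ℝ), hq⟩ : Sigma2) = shift (h p) := by
  refine ⟨Set.Ioo 5.31245 5.46885 ×ˢ Set.Ioo (1 - 1 / 1000000) (1 + 1 / 1000000),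
    isOpen_Ioo.prod isOpen_Ioo, ?_, ?_, ?_⟩
  · exact (isConnected_Ioo (by norm_num)).prod (isConnected_Ioo (by norm_num))
  · rintro ⟨a, b⟩ ⟨⟨h1, h2⟩, hb⟩
    simp only [Set.mem_singleton_iff] at hb h1 h2
    subst hb
    refine ⟨⟨?_, ?_⟩, ⟨?_, ?_⟩⟩ <;> simp only [] <;> norm_num at * <;> linarith
  · rintro a b ⟨⟨h1, h2⟩, h3, h4⟩
    simp only [] at h1 h2 h3 h4
    have h : HP.Par a b := ⟨h1, h2, h3, h4⟩
    have hb : b ≠ 0 := by intro h0; rw [h0] at h3; norm_num at h3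
    constructor
    · intro p hp
      rw [HP.memK hb] at hp ⊢
      obtain ⟨K, hK⟩ := hp
      exact ⟨K, fun n => by rw [HP.X_henon]; exact hK _⟩
    · haveI : CompactSpace (henonK a b) := isCompact_iff_compactSpace.1 (HP.K_compact hb h)
      refine ⟨Continuous.homeoOfEquivCompactToT2 (f := Equiv.ofBijective _ (HP.hmap_bij hb h))
        (HP.hmap_cont hb h), fun p hq => ?_⟩
      funext n
      change HP.code (a := a) hb (henon a b p) n = HP.code (a := a) hb p (n + 1)
      simp only [HP.code, HP.X_henon]
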